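/- arXiv:1601.08095 — 9 statements merged into one kernel-verified Lean document; each statement's English description precedes it below -/
import Mathlib

section
/- Let 0 < p ≤ 1 and n = ⌈1/p⌉, and assume n ≤ q. For every strategy (a,b), there exists a p-bounded input distribution r* which takes the value p on exactly n−1 elements of F, the value 1−p(n−1) on exactly one further element of F, and the value 0 on all remaining elements, such that for every p-bounded input distribution r one has ω(r,a,b) ≤ ω(r*,a,b). -/
open Finset

/-- The winning probability of the deterministic strategy `(a, b)` in the
`CHSH_q` game, when Alice's input is distributed according to `r` and Bob's
input is uniform: `ω(r,a,b) = (1/q) ∑_x ∑_y r x · [a x + b y = x y]`. -/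
noncomputable def winProb {F : Type*} [Field F] [Fintype F] [DecidableEq F]
    (q : ℕ) (r : F → ℝ) (a b : F → F) : ℝ :=
  (1 / (q : ℝ)) * ∑ x : F, ∑ y : F, r x * (if a x + b y = x * y then (1 : ℝ) else 0)

theorem exists_finset_card_eq_forall_le {α β : Type*} [Fintype α] [DecidableEq α]
    [LinearOrder β] (w : α → β) (k : ℕ) (hk : k < Fintype.card α) :
    ∃ (A : Finset α) (x₀ : α), A.card = k ∧ x₀ ∉ A ∧
      (∀ x ∈ A, w x₀ ≤ w x) ∧ ∀ x ∉ A, w x ≤ w x₀ := by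
  induction k with
  | zero =>
    have : Nonempty α := Fintype.card_pos_iff.mp hk
    obtain ⟨x₀, hx₀⟩ := Finite.exists_max w
    exact ⟨∅, x₀, by simp, by simp, by simp, fun x _ => hx₀ x⟩
  | succ k ih =>
    obtain ⟨A, x₀, hA, hx₀, hge, hle⟩ := ih (by lia)
    have hcard : (insert x₀ A).card = k + 1 := by rw [card_insert_of_notMem hx₀, hA]
    have hne : (insert x₀ A)ᶜ.Nonempty := by
      rw [← card_pos, card_compl]
      lia
    obtain ⟨x₁, hx₁, hmax⟩ := exists_max_image _ w hne
    rw [mem_compl] at hx₁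
    have hx₁A : x₁ ∉ A := fun h => hx₁ (mem_insert_of_mem h)
    refine ⟨insert x₀ A, x₁, hcard, hx₁, fun x hx => ?_, fun x hx => hmax x (mem_compl.mpr hx)⟩
    rcases mem_insert.mp hx with rfl | hx
    · exact hle x₁ hx₁A
    · exact (hle x₁ hx₁A).trans (hge x hx)

theorem winProb_eq_sum_mul {F : Type*} [Field F] [Fintype F] [DecidableEq F]
    (q : ℕ) (r : F → ℝ) (a b : F → F) :
    winProb q r a b =
      (1 / (q : ℝ)) * ∑ x, r x * ∑ y, if a x + b y = x * y then (1 : ℝ) else 0 := by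
  simp only [winProb, mul_sum]

/-- For `0 < p ≤ 1`, `n = ⌈1/p⌉ ≤ q`, and any strategy `(a,b)`, there is a
`p`-bounded input distribution `r'` taking value `p` on exactly `n-1` elements,
value `1 - p(n-1)` on one further element, and `0` elsewhere, which is optimal
among all `p`-bounded input distributions for the strategy `(a,b)`. -/
theorem chsh_optimal_distribution {F : Type*} [Field F] [Fintype F] [DecidableEq F]
    (q : ℕ) (hq : Fintype.card F = q)
    (p : ℝ) (hp0 : 0 < p) (hp1 : p ≤ 1)
    (n : ℕ) (hn : n = ⌈1 / p⌉₊) (hnq : n ≤ q)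
    (a b : F → F) :
    ∃ r' : F → ℝ,
      (∀ x, 0 ≤ r' x) ∧ (∑ x : F, r' x = 1) ∧ (∀ x, r' x ≤ p) ∧
      (∃ (A : Finset F) (x₀ : F), A.card = n - 1 ∧ x₀ ∉ A ∧
        (∀ x ∈ A, r' x = p) ∧ r' x₀ = 1 - p * ((n : ℝ) - 1) ∧
        (∀ x, x ∉ A → x ≠ x₀ → r' x = 0)) ∧
      (∀ r : F → ℝ, (∀ x, 0 ≤ r x) → (∑ x : F, r x = 1) → (∀ x, r x ≤ p) →
        winProb q r a b ≤ winProb q r' a b) := by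
  set w : F → ℝ := fun x => ∑ y, if a x + b y = x * y then (1 : ℝ) else 0 with hw
  have hn0 : 0 < n := by
    rw [hn, Nat.ceil_pos]
    positivity
  have hcast : ((n - 1 : ℕ) : ℝ) = (n : ℝ) - 1 := by
    rw [Nat.cast_sub hn0, Nat.cast_one]
  have hub : 1 ≤ p * n := by
    have h := Nat.le_ceil (1 / p)
    rwa [← hn, div_le_iff₀ hp0, mul_comm] at h
  have hlb : p * ((n : ℝ) - 1) ≤ 1 := by
    have h := Nat.ceil_lt_add_one (one_div_pos.mpr hp0).le
    rw [← hn, ← sub_lt_iff_lt_add, lt_div_iff₀ hp0] at h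
    linarith
  obtain ⟨A, x₀, hA, hx₀, hge, hle⟩ := exists_finset_card_eq_forall_le w (n - 1) (by lia)
  let r' : F → ℝ := fun x => if x ∈ A then p else if x = x₀ then 1 - p * ((n : ℝ) - 1) else 0
  have hrA : ∀ x ∈ A, r' x = p := fun x hx => if_pos hx
  have hr₀ : r' x₀ = 1 - p * ((n : ℝ) - 1) := by simp [r', hx₀]
  have hr : ∀ x, x ∉ A → x ≠ x₀ → r' x = 0 := fun x hx hne => by simp [r', hx, hne]
  have hsum : ∑ x, r' x = 1 := by
    rw [← sum_subset (subset_univ (insert x₀ A)) fun x _ hx => ?_, sum_insert hx₀, hr₀,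
      sum_congr rfl hrA, sum_const, hA, nsmul_eq_mul, hcast]
    · ring
    · rw [mem_insert, not_or] at hx
      exact hr x hx.2 hx.1
  refine ⟨r', fun x => ?_, hsum, fun x => ?_, ⟨A, x₀, hA, hx₀, hrA, hr₀, hr⟩,
    fun r h0 h1 hp => ?_⟩
  · dsimp only [r']
    split_ifs <;> linarith
  · dsimp only [r']
    split_ifs <;> linarith
  · rw [winProb_eq_sum_mul, winProb_eq_sum_mul]
    refine mul_le_mul_of_nonneg_left ?_ (by positivity)
    have hterm : 0 ≤ ∑ x, (r' x - r x) * (w x - w x₀) := sum_nonneg fun x _ => by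
      by_cases hx : x ∈ A
      · rw [hrA x hx]
        exact mul_nonneg (sub_nonneg.mpr (hp x)) (sub_nonneg.mpr (hge x hx))
      · by_cases hne : x = x₀
        · simp [hne]
        · rw [hr x hx hne]
          exact mul_nonneg_of_nonpos_of_nonpos (by linarith [h0 x]) (sub_nonpos.mpr (hle x hx))
    have hexp : ∑ x, (r' x - r x) * (w x - w x₀) = ∑ x, r' x * w x - ∑ x, r x * w x := by
      simp only [mul_sub, sub_mul, sum_sub_distrib, ← sum_mul, hsum, h1]
      ring
    exact sub_nonneg.mp (hexp ▸ hterm)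
end

section
/- For all natural numbers n ≥ 2 and k with q ≥ k ≥ n(n−1)/2, the maximum of I(P,L) over all sets P ⊆ F² of n distinct points and all sets L of k distinct non-vertical lines in F² equals k + n(n−1)/2. -/
open Finset

/-- The number of incidences between a finite set `P` of points of `F²` and a
finite set `L` of non-vertical lines of `F²`, where a line is identified with
its pair `(slope, offset)`: a point `(x, y)` lies on the line `(s, t)` iff
`y = s * x + t`. -/
def incidences {F : Type*} [Field F] [DecidableEq F] (P L : Finset (F × F)) : ℕ :=
  ((P ×ˢ L).filter (fun pl => pl.1.2 = pl.2.1 * pl.1.1 + pl.2.2)).card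

/-- Two distinct points lie on at most one common line. -/
theorem line_unique {F : Type*} [Field F] {a b l m : F × F} (hab : a ≠ b)
    (hal : a.2 = l.1 * a.1 + l.2) (hbl : b.2 = l.1 * b.1 + l.2)
    (ham : a.2 = m.1 * a.1 + m.2) (hbm : b.2 = m.1 * b.1 + m.2) : l = m := by
  have hx : a.1 - b.1 ≠ 0 := by
    intro h
    have h' : a.1 = b.1 := sub_eq_zero.mp h
    exact hab (Prod.ext h' (by rw [hal, hbl, h']))
  have hs : l.1 = m.1 := by
    apply mul_right_cancel₀ hx
    linear_combination hbl - hal + ham - hbm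
  refine Prod.ext hs ?_
  rw [hs] at hal
  linear_combination ham - hal

/-- The points of `P` that lie on the line `l`. -/
def pointsOn {F : Type*} [Field F] [DecidableEq F] (P : Finset (F × F)) (l : F × F) :
    Finset (F × F) :=
  P.filter (fun p => p.2 = l.1 * p.1 + l.2)

section

variable {F : Type*} [Field F] [DecidableEq F]

theorem mem_pointsOn {P : Finset (F × F)} {l p : F × F} :
    p ∈ pointsOn P l ↔ p ∈ P ∧ p.2 = l.1 * p.1 + l.2 := by
  simp [pointsOn]

theorem incidences_eq_sum (P L : Finset (F × F)) :
    incidences P L = ∑ l ∈ L, #(pointsOn P l) := by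
  simp only [incidences, pointsOn, card_filter, sum_product_right]

theorem pairwiseDisjoint_pairs (P L : Finset (F × F)) :
    (L : Set (F × F)).PairwiseDisjoint (fun l => powersetCard 2 (pointsOn P l)) := by
  intro l _ m _ hlm
  refine disjoint_left.mpr fun s hsl hsm => hlm ?_
  rw [mem_powersetCard] at hsl hsm
  obtain ⟨a, b, hab, rfl⟩ := card_eq_two.mp hsl.2
  have h {c : F × F} (hc : c ∈ ({a, b} : Finset (F × F))) :=
    And.intro (mem_pointsOn.mp (hsl.1 hc)).2 (mem_pointsOn.mp (hsm.1 hc)).2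
  have ha := h (c := a) (by simp)
  have hb := h (c := b) (by simp)
  exact line_unique hab ha.1 hb.1 ha.2 hb.2

theorem sum_choose_two (P L : Finset (F × F)) :
    ∑ l ∈ L, (#(pointsOn P l)).choose 2 =
      #(L.biUnion fun l => powersetCard 2 (pointsOn P l)) := by
  rw [card_biUnion (pairwiseDisjoint_pairs P L)]
  simp [card_powersetCard]

theorem biUnion_pairs_subset (P L : Finset (F × F)) :
    (L.biUnion fun l => powersetCard 2 (pointsOn P l)) ⊆ powersetCard 2 P :=
  biUnion_subset.mpr fun _ _ => powersetCard_mono (filter_subset _ _)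

theorem incidences_le (P L : Finset (F × F)) :
    incidences P L ≤ #L + (#P).choose 2 := by
  have hr (r : ℕ) : r ≤ 1 + r.choose 2 := by
    rcases r with _ | _ | r
    · simp
    · simp
    · have := Nat.choose_succ_succ' (r + 1) 1
      rw [Nat.choose_one_right] at this
      norm_num at this ⊢
      omega
  calc incidences P L = ∑ l ∈ L, #(pointsOn P l) := incidences_eq_sum P L
    _ ≤ ∑ l ∈ L, (1 + (#(pointsOn P l)).choose 2) := sum_le_sum fun l _ => hr _
    _ = #L + #(L.biUnion fun l => powersetCard 2 (pointsOn P l)) := by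
      rw [sum_add_distrib, sum_choose_two]; simp
    _ ≤ #L + (#P).choose 2 := by
      rw [← card_powersetCard]
      exact Nat.add_le_add_left (card_le_card (biUnion_pairs_subset P L)) _

/-- The points of the parabola `y = x²` with abscissa in `S`. -/
def parabola (S : Finset F) : Finset (F × F) := S.image fun x => (x, x ^ 2)

theorem card_parabola (S : Finset F) : #(parabola S) = #S :=
  card_image_of_injective _ fun _ _ h => congrArg Prod.fst h

theorem snd_of_mem_parabola {S : Finset F} {p : F × F} (hp : p ∈ parabola S) :
    p.2 = p.1 ^ 2 := by
  obtain ⟨x, -, rfl⟩ := mem_image.mp hp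
  rfl

theorem fst_ne_of_mem_parabola {S : Finset F} {p r : F × F} (hp : p ∈ parabola S)
    (hr : r ∈ parabola S) (h : p ≠ r) : p.1 - r.1 ≠ 0 := fun h' =>
  h (Prod.ext (sub_eq_zero.mp h')
    (by rw [snd_of_mem_parabola hp, snd_of_mem_parabola hr, sub_eq_zero.mp h']))

theorem card_pointsOn_parabola_le (S : Finset F) (l : F × F) :
    #(pointsOn (parabola S) l) ≤ 2 := by
  by_contra! h
  obtain ⟨a, ha, b, hb, c, hc, hab, hac, hbc⟩ := two_lt_card.mp h
  rw [mem_pointsOn] at ha hb hc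
  have ea := (snd_of_mem_parabola ha.1).symm.trans ha.2
  have eb := (snd_of_mem_parabola hb.1).symm.trans hb.2
  have ec := (snd_of_mem_parabola hc.1).symm.trans hc.2
  have h₁ : a.1 + b.1 = l.1 := by
    apply mul_right_cancel₀ (fst_ne_of_mem_parabola ha.1 hb.1 hab)
    linear_combination ea - eb
  have h₂ : a.1 + c.1 = l.1 := by
    apply mul_right_cancel₀ (fst_ne_of_mem_parabola ha.1 hc.1 hac)
    linear_combination ea - ec
  exact fst_ne_of_mem_parabola hb.1 hc.1 hbc (by linear_combination h₁ - h₂)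

variable [Fintype F]

/-- The number of lines meeting the parabola points over `S` twice. -/
theorem card_secants (S : Finset F) :
    #{l | #(pointsOn (parabola S) l) = 2} = (#S).choose 2 := by
  have hcover : (univ.biUnion fun l => powersetCard 2 (pointsOn (parabola S) l)) =
      powersetCard 2 (parabola S) := by
    refine (biUnion_pairs_subset _ _).antisymm fun s hs => ?_
    rw [mem_powersetCard] at hs
    obtain ⟨a, b, hab, rfl⟩ := card_eq_two.mp hs.2
    have ha : a ∈ parabola S := hs.1 (by simp)
    have hb : b ∈ parabola S := hs.1 (by simp)
    refine mem_biUnion.mpr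
      ⟨(a.1 + b.1, -(a.1 * b.1)), mem_univ _, mem_powersetCard.mpr ⟨?_, hs.2⟩⟩
    intro c hc
    rw [mem_insert, mem_singleton] at hc
    rcases hc with rfl | rfl
    · refine mem_pointsOn.mpr ⟨ha, ?_⟩
      rw [snd_of_mem_parabola ha]
      ring
    · refine mem_pointsOn.mpr ⟨hb, ?_⟩
      rw [snd_of_mem_parabola hb]
      ring
  rw [← card_parabola S, ← card_powersetCard, ← hcover, ← sum_choose_two, card_filter]
  refine sum_congr rfl fun l _ => ?_
  have := card_pointsOn_parabola_le S l
  generalize #(pointsOn (parabola S) l) = r at this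
  interval_cases r <;> simp

/-- At least `|F|` lines meet a nonempty set of points. -/
theorem card_le_card_meeting {P : Finset (F × F)} (hP : P.Nonempty) :
    Fintype.card F ≤ #{l | 1 ≤ #(pointsOn P l)} := by
  obtain ⟨p, hp⟩ := hP
  rw [← card_univ]
  refine card_le_card_of_injOn (fun s => (s, p.2 - s * p.1)) (fun s _ => ?_)
    fun _ _ _ _ h => congrArg Prod.fst h
  simp only [coe_filter, mem_univ, true_and, Set.mem_ofPred_eq]
  exact card_pos.mpr ⟨p, mem_pointsOn.mpr ⟨hp, by ring⟩⟩

theorem exists_lines_parabola {S : Finset F} (hS : S.Nonempty) {k : ℕ}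
    (hk : (#S).choose 2 ≤ k) (hkF : k ≤ Fintype.card F) :
    ∃ L : Finset (F × F), #L = k ∧ incidences (parabola S) L = k + (#S).choose 2 := by
  have hsub : ({l | #(pointsOn (parabola S) l) = 2} : Finset (F × F)) ⊆
      ({l | 1 ≤ #(pointsOn (parabola S) l)} : Finset (F × F)) :=
    monotone_filter_right _ fun l _ hl => by omega
  obtain ⟨L, hAL, hLB, hL⟩ := exists_subsuperset_card_eq hsub
    (by rwa [card_secants]) (hkF.trans (card_le_card_meeting (hS.image _)))
  refine ⟨L, hL, ?_⟩
  have hA : ({l | #(pointsOn (parabola S) l) = 2} : Finset (F × F)) =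
      L.filter fun l => #(pointsOn (parabola S) l) = 2 := by
    ext l
    have := @hAL l
    simp only [mem_filter, mem_univ, true_and] at this ⊢
    tauto
  rw [incidences_eq_sum, ← card_secants S, hA, card_filter, ← hL, card_eq_sum_ones,
    ← sum_add_distrib]
  refine sum_congr rfl fun l hl => ?_
  have h₁ := (mem_filter.mp (hLB hl)).2
  have h₂ := card_pointsOn_parabola_le S l
  split_ifs <;> omega

end

/-- For `n ≥ 2` and `q ≥ k ≥ n(n-1)/2`, the maximum number of incidences
between a set of `n` points and a set of `k` non-vertical lines in `F²`
equals `k + n(n-1)/2`. -/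
theorem max_incidences {F : Type*} [Field F] [Fintype F] [DecidableEq F]
    (q : ℕ) (hq : Fintype.card F = q)
    (n k : ℕ) (hn : 2 ≤ n) (hkq : k ≤ q) (hnk : n * (n - 1) / 2 ≤ k) :
    IsGreatest {I : ℕ | ∃ P L : Finset (F × F),
        P.card = n ∧ L.card = k ∧ incidences P L = I}
      (k + n * (n - 1) / 2) := by
  subst hq
  rw [← Nat.choose_two_right] at hnk ⊢
  constructor
  · have hnF : n ≤ Fintype.card F := by
      rcases hn.eq_or_lt with rfl | hn
      · exact Fintype.one_lt_card
      · refine le_trans ?_ (hnk.trans hkq)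
        rw [Nat.choose_two_right, Nat.le_div_iff_mul_le two_pos]
        exact Nat.mul_le_mul_left n (by omega)
    obtain ⟨S, -, rfl⟩ := exists_subset_card_eq (hnF.trans_eq card_univ.symm)
    obtain ⟨L, hL, hI⟩ := exists_lines_parabola (card_pos.mp (by omega)) hnk hkq
    exact ⟨parabola S, L, card_parabola S, hL, hI⟩
  · rintro _ ⟨P, L, rfl, rfl, rfl⟩
    exact incidences_le P L
end

section
/- For all natural numbers n ≥ 2 and k with q ≥ k ≥ n(n−1)/2, there exist a set P ⊆ F² of n distinct points and a set L of k distinct non-vertical lines in F² with I(P,L) = k + n(n−1)/2; moreover P and L can be chosen so that no three points of P lie on a common line of L, every pair of distinct points of P is joined by a line of L, and every line of L contains at least one point of P. -/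
open Finset

/-- The line through the points of the parabola `y = x²` with abscissas in `s`,
for a set `s` of two elements. -/
def parabolaChord {F : Type*} [Field F] (s : Finset F) : F × F :=
  (∑ a ∈ s, a, -∏ a ∈ s, a)

theorem parabolaChord_pair {F : Type*} [Field F] [DecidableEq F] {a b : F} (hab : a ≠ b) :
    parabolaChord {a, b} = (a + b, -(a * b)) := by
  simp [parabolaChord, sum_pair hab, prod_pair hab]

theorem filter_parabolaChord {F : Type*} [Field F] [DecidableEq F] {A s : Finset F}
    (hs : s ∈ powersetCard 2 A) :
    A.filter (fun x => x ^ 2 = (parabolaChord s).1 * x + (parabolaChord s).2) = s := by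
  obtain ⟨hsA, hs2⟩ := mem_powersetCard.1 hs
  obtain ⟨a, b, hab, rfl⟩ := card_eq_two.1 hs2
  rw [parabolaChord_pair hab]
  ext x
  have hx : x ^ 2 = (a + b) * x + -(a * b) ↔ x = a ∨ x = b := by
    rw [← sub_eq_zero, ← sub_eq_zero (a := x) (b := a), ← sub_eq_zero (a := x) (b := b),
      ← mul_eq_zero]
    ring_nf
  simp only [mem_filter, hx, mem_insert, mem_singleton, and_iff_right_iff_imp]
  exact fun h => hsA (by simpa using h)

theorem eq_parabolaChord {F : Type*} [Field F] [DecidableEq F] {a b : F} (hab : a ≠ b)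
    {l : F × F} (ha : a ^ 2 = l.1 * a + l.2) (hb : b ^ 2 = l.1 * b + l.2) :
    l = parabolaChord {a, b} := by
  have h1 : l.1 = a + b := by
    apply mul_right_cancel₀ (sub_ne_zero.2 hab)
    linear_combination hb - ha
  rw [parabolaChord_pair hab]
  refine Prod.ext h1 ?_
  linear_combination -ha - a * h1

theorem incidences_eq_sum_s3 {F : Type*} [Field F] [DecidableEq F] (P L : Finset (F × F)) :
    incidences P L = ∑ l ∈ L, (P.filter (fun pt => pt.2 = l.1 * pt.1 + l.2)).card := by
  simp only [incidences, card_filter, sum_product_right]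

/-- For `n ≥ 2` and `q ≥ k ≥ n(n-1)/2` there are a set `P` of `n` points and a
set `L` of `k` non-vertical lines in `F²` with exactly `k + n(n-1)/2`
incidences; moreover `P` and `L` can be chosen so that no line of `L` contains
three points of `P`, every pair of distinct points of `P` is joined by a line
of `L`, and every line of `L` contains at least one point of `P`. -/
theorem exists_max_incidence_configuration {F : Type*} [Field F] [Fintype F] [DecidableEq F]
    (q : ℕ) (hq : Fintype.card F = q)
    (n k : ℕ) (hn : 2 ≤ n) (hkq : k ≤ q) (hnk : n * (n - 1) / 2 ≤ k) :
    ∃ P L : Finset (F × F), P.card = n ∧ L.card = k ∧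
      incidences P L = k + n * (n - 1) / 2 ∧
      (∀ ℓ ∈ L, (P.filter (fun pt => pt.2 = ℓ.1 * pt.1 + ℓ.2)).card ≤ 2) ∧
      (∀ p₁ ∈ P, ∀ p₂ ∈ P, p₁ ≠ p₂ →
        ∃ ℓ ∈ L, p₁.2 = ℓ.1 * p₁.1 + ℓ.2 ∧ p₂.2 = ℓ.1 * p₂.1 + ℓ.2) ∧
      (∀ ℓ ∈ L, ∃ pt ∈ P, pt.2 = ℓ.1 * pt.1 + ℓ.2) := by
  have hq2 : 2 ≤ Fintype.card F := Fintype.one_lt_card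
  have hchoose : n * (n - 1) / 2 = n.choose 2 := (Nat.choose_two_right n).symm
  rw [hchoose] at hnk ⊢
  have hnq : n ≤ Fintype.card F := by
    rcases hn.eq_or_lt with rfl | h3
    · exact hq2
    · have : n * 2 ≤ n * (n - 1) := Nat.mul_le_mul_left n (by omega)
      omega
  obtain ⟨A, -, hA⟩ := exists_subset_card_eq (s := (univ : Finset F)) (by simpa using hnq)
  obtain ⟨a₀, ha₀⟩ : A.Nonempty := card_pos.1 (by omega)
  set C := (powersetCard 2 A).image parabolaChord with hC
  set T := (univ : Finset F).image (fun s => (s, a₀ ^ 2 - s * a₀)) with hT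
  have hCcard : C.card = n.choose 2 := by
    rw [hC, card_image_of_injOn, card_powersetCard, hA]
    intro s hs t ht hst
    rw [← filter_parabolaChord hs, ← filter_parabolaChord ht, hst]
  have hTcard : T.card = q := by
    rw [hT, card_image_of_injective _ fun s t h => (Prod.ext_iff.1 h).1, card_univ, hq]
  obtain ⟨L, hCL, hLU, hLk⟩ := exists_subsuperset_card_eq (s := C) (t := C ∪ T) (n := k)
    subset_union_left (by omega) (hkq.trans (hTcard ▸ card_le_card subset_union_right))
  have hinj : Function.Injective (fun a : F => (a, a ^ 2)) := fun a b h => (Prod.ext_iff.1 h).1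
  have hcount (l : F × F) : ((A.image (fun a => (a, a ^ 2))).filter
      (fun pt => pt.2 = l.1 * pt.1 + l.2)).card =
      (A.filter (fun x => x ^ 2 = l.1 * x + l.2)).card := by
    rw [filter_image, card_image_of_injective _ hinj]
  have hcard : ∀ l ∈ L, (A.filter (fun x => x ^ 2 = l.1 * x + l.2)).card =
      1 + if l ∈ C then 1 else 0 := by
    intro l hl
    split_ifs with hlC
    · obtain ⟨s, hs, rfl⟩ := mem_image.1 hlC
      rw [filter_parabolaChord hs, (mem_powersetCard.1 hs).2]
    · obtain ⟨m, -, rfl⟩ := mem_image.1 ((mem_union.1 (hLU hl)).resolve_left hlC)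
      refine card_eq_one.2 ⟨a₀, eq_singleton_iff_unique_mem.2 ⟨by simp [ha₀], ?_⟩⟩
      intro b hb
      obtain ⟨hbA, hb⟩ := mem_filter.1 hb
      by_contra hne
      refine hlC (mem_image.2 ⟨{b, a₀}, ?_, (eq_parabolaChord hne hb (by simp)).symm⟩)
      exact mem_powersetCard.2 ⟨by simp [insert_subset_iff, hbA, ha₀], card_pair hne⟩
  refine ⟨A.image (fun a => (a, a ^ 2)), L, ?_, hLk, ?_, ?_, ?_, ?_⟩
  · rw [card_image_of_injective _ hinj, hA]
  · rw [incidences_eq_sum_s3, sum_congr rfl fun l hl => (hcount l).trans (hcard l hl),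
      sum_add_distrib, ← card_filter, filter_mem_eq_inter, inter_eq_right.2 hCL]
    simp [hLk, hCcard]
  · intro l hl
    rw [hcount, hcard l hl]
    split_ifs <;> simp
  · intro p₁ hp₁ p₂ hp₂ hne
    obtain ⟨a, ha, rfl⟩ := mem_image.1 hp₁
    obtain ⟨b, hb, rfl⟩ := mem_image.1 hp₂
    have hab : a ≠ b := fun h => hne (by rw [h])
    refine ⟨parabolaChord {a, b}, hCL (mem_image_of_mem _ (mem_powersetCard.2
      ⟨by simp [insert_subset_iff, ha, hb], card_pair hab⟩)), ?_, ?_⟩ <;>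
    · rw [parabolaChord_pair hab]
      ring
  · intro l hl
    obtain ⟨x, hx⟩ : (A.filter (fun x => x ^ 2 = l.1 * x + l.2)).Nonempty :=
      card_pos.1 (by rw [hcard l hl]; omega)
    obtain ⟨hxA, hx⟩ := mem_filter.1 hx
    exact ⟨(x, x ^ 2), mem_image_of_mem _ hxA, hx⟩
end

section
/- Let 0 < p ≤ 1, n = ⌈1/p⌉, and assume q ≥ n(n−1)/2. Then for every p-bounded input distribution r and every strategy (a,b), the winning probability satisfies ω(r,a,b) ≤ p + ((n−1)/q)·(1 − n·p/2). -/
open Finset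

/-- A finite family of sets that pairwise meet in at most one point is almost disjoint. -/
theorem sum_card_le_card_biUnion_add_choose {α β : Type*} [DecidableEq α] [DecidableEq β]
    (S : α → Finset β) (hS : ∀ x y, x ≠ y → #(S x ∩ S y) ≤ 1) (T : Finset α) :
    ∑ x ∈ T, #(S x) ≤ #(T.biUnion S) + (#T).choose 2 := by
  induction T using Finset.induction_on with
  | empty => simp
  | insert a T ha ih =>
    have hinter : #(S a ∩ T.biUnion S) ≤ #T := by
      rw [inter_biUnion]
      refine card_biUnion_le.trans ((sum_le_card_nsmul T _ 1 fun x hx => hS a x ?_).trans ?_)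
      · rintro rfl
        exact ha hx
      · simp
    have hunion := card_union_add_card_inter (S a) (T.biUnion S)
    rw [sum_insert ha, biUnion_insert, card_insert_of_notMem ha,
      show (#T + 1).choose 2 = (#T).choose 1 + (#T).choose 2 from rfl, Nat.choose_one_right]
    omega

/-- A function on a finite type has a set of `n` largest values, for every admissible `n`. -/
theorem exists_card_eq_forall_notMem_le {α β : Type*} [Fintype α] [DecidableEq α] [LinearOrder β]
    (d : α → β) (n : ℕ) (hn : n ≤ Fintype.card α) :
    ∃ T : Finset α, #T = n ∧ ∀ x ∈ T, ∀ y ∉ T, d y ≤ d x := by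
  induction n with
  | zero => exact ⟨∅, by simp⟩
  | succ n ih =>
    obtain ⟨T, hT, hmax⟩ := ih (by omega)
    have hne : Tᶜ.Nonempty := by
      rw [← card_pos, card_compl]
      omega
    obtain ⟨m, hm, hle⟩ := exists_max_image Tᶜ d hne
    rw [mem_compl] at hm
    refine ⟨insert m T, by rw [card_insert_of_notMem hm, hT], fun x hx y hy => ?_⟩
    rw [mem_insert, not_or] at hy
    rcases mem_insert.1 hx with rfl | hx
    · exact hle y (mem_compl.2 hy.2)
    · exact hmax x hx y hy.2

/-- If `m` minimizes `d` on `T` and `d` is at most `d m` off `T`, then a weight `r ≤ p` of total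
mass `1` gives `d` at most the average obtained by putting mass `p` on `T` and correcting at `m`. -/
theorem sum_mul_le_of_forall_le {α : Type*} [Fintype α] [DecidableEq α] (r d : α → ℝ) (p : ℝ)
    (hr0 : ∀ x, 0 ≤ r x) (hr1 : ∑ x, r x = 1) (hrp : ∀ x, r x ≤ p) (T : Finset α) (m : α)
    (hin : ∀ x ∈ T, d m ≤ d x) (hout : ∀ x ∉ T, d x ≤ d m) :
    ∑ x, r x * d x ≤ p * ∑ x ∈ T, d x + (1 - #T * p) * d m := by
  have hshift : ∑ x, r x * d x = ∑ x, r x * (d x - d m) + d m := by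
    simp only [mul_sub, sum_sub_distrib, ← sum_mul, hr1]
    ring
  have hbound : ∑ x, r x * (d x - d m) ≤ ∑ x ∈ T, p * (d x - d m) := by
    rw [← sum_add_sum_compl T]
    have hT : ∑ x ∈ T, r x * (d x - d m) ≤ ∑ x ∈ T, p * (d x - d m) :=
      sum_le_sum fun x hx => mul_le_mul_of_nonneg_right (hrp x) (sub_nonneg.2 (hin x hx))
    have hTc : ∑ x ∈ Tᶜ, r x * (d x - d m) ≤ 0 :=
      sum_nonpos fun x hx => mul_nonpos_of_nonneg_of_nonpos (hr0 x)
        (sub_nonpos.2 (hout x (mem_compl.1 hx)))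
    linarith
  rw [← mul_sum, sum_sub_distrib, sum_const, nsmul_eq_mul] at hbound
  rw [hshift]
  linarith

/-- Two inputs of Alice share at most one winning input of Bob. -/
theorem card_win_inter_win_le_one {F : Type*} [Field F] [Fintype F] [DecidableEq F]
    (a b : F → F) (x x' : F) (hx : x ≠ x') :
    #(({y | a x + b y = x * y} : Finset F) ∩ ({y | a x' + b y = x' * y} : Finset F)) ≤ 1 := by
  refine card_le_one.2 fun y hy z hz => ?_
  simp only [mem_inter, mem_filter, mem_univ, true_and] at hy hz
  refine mul_left_cancel₀ (sub_ne_zero.2 hx) ?_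
  linear_combination -hy.1 + hy.2 + hz.1 - hz.2

/-- Upper bound on the classical value of `CHSH_q(p)`: for `0 < p ≤ 1`,
`n = ⌈1/p⌉` and `q ≥ n(n-1)/2`, every `p`-bounded input distribution `r` and
every strategy `(a,b)` satisfy `ω(r,a,b) ≤ p + ((n-1)/q)(1 - np/2)`. -/
theorem chsh_upper_bound {F : Type*} [Field F] [Fintype F] [DecidableEq F]
    (q : ℕ) (hq : Fintype.card F = q)
    (p : ℝ) (hp0 : 0 < p) (hp1 : p ≤ 1)
    (n : ℕ) (hn : n = ⌈1 / p⌉₊) (hnq : n * (n - 1) / 2 ≤ q)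
    (r : F → ℝ) (hr0 : ∀ x, 0 ≤ r x) (hr1 : ∑ x : F, r x = 1) (hrp : ∀ x, r x ≤ p)
    (a b : F → F) :
    winProb q r a b ≤ p + ((n : ℝ) - 1) / q * (1 - n * p / 2) := by
  have hn1 : 1 ≤ n := by
    rw [hn]
    exact Nat.ceil_pos.2 (by positivity)
  have hnp : 1 ≤ n * p := by
    rw [← div_le_iff₀ hp0, hn]
    exact Nat.le_ceil _
  have hnp' : (n - 1 : ℝ) * p ≤ 1 := by
    have h := Nat.ceil_lt_add_one (a := 1 / p) (by positivity)
    rw [← hn] at h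
    rw [← le_div_iff₀ hp0]
    linarith
  have hcard : n ≤ Fintype.card F := by
    rw [hn, Nat.ceil_le, div_le_iff₀ hp0, ← hr1]
    simpa using sum_le_card_nsmul univ r p fun x _ => hrp x
  have hq0 : (0 : ℝ) < q := by
    rw [← hq]
    exact_mod_cast Fintype.card_pos
  set S : F → Finset F := fun x => {y | a x + b y = x * y} with hS
  have hwin : winProb q r a b = 1 / q * ∑ x, r x * (#(S x) : ℝ) := by
    simp only [winProb, hS, ← mul_sum, sum_boole]
  have hsum (T : Finset F) : ∑ x ∈ T, (#(S x) : ℝ) ≤ q + #T * (#T - 1) / 2 := by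
    have h := (sum_card_le_card_biUnion_add_choose S (card_win_inter_win_le_one a b) T).trans
      (Nat.add_le_add_right (hq ▸ card_le_univ _) _)
    rw [← Nat.cast_choose_two]
    exact_mod_cast h
  obtain ⟨T, hT, hmax⟩ := exists_card_eq_forall_notMem_le (fun x => (#(S x) : ℝ)) n hcard
  obtain ⟨m, hm, hmin⟩ := exists_min_image T (fun x => (#(S x) : ℝ)) (card_pos.1 (by omega))
  have hvalue := sum_mul_le_of_forall_le r (fun x => (#(S x) : ℝ)) p hr0 hr1 hrp T m hmin
    (hmax m hm)
  have hall := hsum T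
  have herase := hsum (T.erase m)
  rw [card_erase_of_mem hm, hT, Nat.cast_sub hn1, Nat.cast_one] at herase
  rw [hT] at hall hvalue
  rw [← add_sum_erase T _ hm] at hall hvalue
  have hall' := mul_le_mul_of_nonneg_left hall (sub_nonneg.2 hnp')
  have herase' := mul_le_mul_of_nonneg_left herase (sub_nonneg.2 hnp)
  have hmain : ∑ x, r x * (#(S x) : ℝ) ≤ p * q + (n - 1) * (1 - n * p / 2) := by
    linarith
  calc winProb q r a b = 1 / q * ∑ x, r x * (#(S x) : ℝ) := hwin
    _ ≤ 1 / q * (p * q + (n - 1) * (1 - n * p / 2)) := by gcongr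
    _ = p + ((n : ℝ) - 1) / q * (1 - n * p / 2) := by field_simp
end

section
/- Let p be a real number with 1/√(2q) ≤ p ≤ 1. Then for every p-bounded input distribution r and every strategy (a,b), the winning probability satisfies ω(r,a,b) ≤ p + 1/(2pq). -/
open Finset

/-- The pairwise products of numbers in `[0, p]` with sum `s` add up to at least `p * (s - p)`;
twice their sum is written as `s ^ 2 - ∑ u i ^ 2`. -/
theorem two_mul_mul_sum_sub_le {ι : Type*} [DecidableEq ι] (T : Finset ι) (u : ι → ℝ) (p : ℝ)
    (h0 : ∀ i, 0 ≤ u i) (hp : ∀ i, u i ≤ p) :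
    ∑ i ∈ T, u i ^ 2 ≤ (∑ i ∈ T, u i) ^ 2 ∧
      2 * p * ((∑ i ∈ T, u i) - p) ≤ (∑ i ∈ T, u i) ^ 2 - ∑ i ∈ T, u i ^ 2 := by
  induction T using Finset.induction_on with
  | empty => simpa using by nlinarith [sq_nonneg p]
  | insert t T ht ih =>
    rw [sum_insert ht, sum_insert ht]
    obtain ⟨hsq, hpair⟩ := ih
    have hs : 0 ≤ ∑ i ∈ T, u i := sum_nonneg fun i _ => h0 i
    have hst := mul_nonneg hs (h0 t)
    refine ⟨by nlinarith, ?_⟩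
    rcases le_total p (∑ i ∈ T, u i) with h | h
    · nlinarith [mul_nonneg (h0 t) (sub_nonneg.2 h)]
    · nlinarith [mul_nonneg (sub_nonneg.2 h) (sub_nonneg.2 (hp t))]

/-- Two lines of distinct slopes share at most one point. -/
theorem sum_win_mul_win_le_one {F : Type*} [Field F] [Fintype F] [DecidableEq F]
    (a b : F → F) {x x' : F} (hx : x ≠ x') :
    ∑ y : F, (if a x + b y = x * y then (1 : ℝ) else 0) *
      (if a x' + b y = x' * y then (1 : ℝ) else 0) ≤ 1 := by
  have hcard : #{y : F | a x + b y = x * y ∧ a x' + b y = x' * y} ≤ 1 := by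
    refine card_le_one.2 fun y hy z hz => ?_
    simp only [mem_filter, mem_univ, true_and] at hy hz
    refine mul_left_cancel₀ (sub_ne_zero.2 hx) ?_
    linear_combination hy.2 - hy.1 - hz.2 + hz.1
  simp only [ite_zero_mul_ite_zero, mul_one, sum_boole]
  exact_mod_cast hcard

/-- The total weight of ordered pairs of distinct inputs that win simultaneously,
summed over Bob's inputs, is at most `1`. -/
theorem sum_sq_sub_sum_sq_le_one {F : Type*} [Field F] [Fintype F] [DecidableEq F]
    (r : F → ℝ) (hr0 : ∀ x, 0 ≤ r x) (hr1 : ∑ x : F, r x = 1) (a b : F → F) :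
    ∑ y : F, ((∑ x : F, r x * (if a x + b y = x * y then (1 : ℝ) else 0)) ^ 2 -
      ∑ x : F, (r x * (if a x + b y = x * y then (1 : ℝ) else 0)) ^ 2) ≤ 1 := by
  set w : F → F → ℝ := fun x y => if a x + b y = x * y then (1 : ℝ) else 0
  calc ∑ y, ((∑ x, r x * w x y) ^ 2 - ∑ x, (r x * w x y) ^ 2)
      = ∑ y, ∑ x, ∑ x', (if x = x' then 0 else r x * r x' * (w x y * w x' y)) := by
        refine sum_congr rfl fun y _ => ?_
        rw [sq, sum_mul_sum, ← sum_sub_distrib]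
        refine sum_congr rfl fun x _ => ?_
        rw [sub_eq_iff_eq_add, ← sum_erase_add _ _ (mem_univ x),
          ← sum_erase_add univ (fun x' => if x = x' then 0 else _) (mem_univ x),
          if_pos rfl, add_zero, sq]
        congr 1
        refine sum_congr rfl fun x' hx' => ?_
        rw [if_neg (ne_of_mem_erase hx').symm]
        ring
    _ = ∑ x, ∑ x', ∑ y, (if x = x' then 0 else r x * r x' * (w x y * w x' y)) := by
        rw [sum_comm]
        exact sum_congr rfl fun x _ => sum_comm
    _ ≤ ∑ x, ∑ x', r x * r x' := by
        refine sum_le_sum fun x _ => sum_le_sum fun x' _ => ?_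
        have hrr := mul_nonneg (hr0 x) (hr0 x')
        split_ifs with h
        · simpa using hrr
        · rw [← mul_sum]
          exact mul_le_of_le_one_right hrr (sum_win_mul_win_le_one a b h)
    _ = 1 := by rw [← sum_mul_sum, hr1, one_mul]

/-- Upper bound on the classical value of `CHSH_q(p)`: for
`1/√(2q) ≤ p ≤ 1`, every `p`-bounded input distribution `r` and every
strategy `(a,b)` satisfy `ω(r,a,b) ≤ p + 1/(2pq)`. -/
theorem chsh_upper_bound' {F : Type*} [Field F] [Fintype F] [DecidableEq F]
    (q : ℕ) (hq : Fintype.card F = q)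
    (p : ℝ) (hp0 : 1 / Real.sqrt (2 * q) ≤ p) (hp1 : p ≤ 1)
    (r : F → ℝ) (hr0 : ∀ x, 0 ≤ r x) (hr1 : ∑ x : F, r x = 1) (hrp : ∀ x, r x ≤ p)
    (a b : F → F) :
    winProb q r a b ≤ p + 1 / (2 * p * q) := by
  have hq0 : (0 : ℝ) < q := by
    rw [← hq]
    exact_mod_cast Fintype.card_pos
  have hp : 0 < p := lt_of_lt_of_le (by positivity) hp0
  have hpairs : ∀ y : F,
      2 * p * ((∑ x, r x * (if a x + b y = x * y then (1 : ℝ) else 0)) - p) ≤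
        (∑ x, r x * (if a x + b y = x * y then (1 : ℝ) else 0)) ^ 2 -
          ∑ x, (r x * (if a x + b y = x * y then (1 : ℝ) else 0)) ^ 2 := fun y => by
    refine (two_mul_mul_sum_sub_le univ _ p (fun x => ?_) fun x => ?_).2
    · split_ifs <;> simp [hr0 x]
    · split_ifs <;> simp [hrp x, hp.le]
  have htotal := (sum_le_sum fun y (_ : y ∈ univ) => hpairs y).trans
    (sum_sq_sub_sum_sq_le_one r hr0 hr1 a b)
  rw [← mul_sum, sum_sub_distrib, sum_const, card_univ, hq, nsmul_eq_mul, sum_comm] at htotal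
  have hbound : p + 1 / (2 * p * q) = 1 / q * (q * p + 1 / (2 * p)) := by
    field_simp
  rw [winProb, hbound]
  gcongr
  rw [← sub_le_iff_le_add', le_div_iff₀' (by positivity)]
  exact htotal
end

section
/- Let 0 < p ≤ 1, n = ⌈1/p⌉ with n ≥ 2, and assume q > (n−1)·((n−2)²/2 + 1). Then there exist a p-bounded input distribution r and a strategy (a,b) such that the winning probability satisfies ω(r,a,b) ≥ p + ((n−1)/q)·(1 − n·p/2). -/
open Finset

/-- Lines with distinct slopes `x i` over a large enough finite field can be given intercepts such
that no two pairs of lines meet above the same abscissa. -/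
lemma exists_intercepts_pairs_meet_apart {F : Type*} [Field F] [Fintype F] [DecidableEq F]
    (x : ℕ → F) (n : ℕ) (hx : Set.InjOn x (Set.Iio n))
    (hn : ∀ m < n, (∑ l ∈ range m, l) * (m - 1) < Fintype.card F) :
    ∃ a : ℕ → F, ∀ i j k l, i < j → j < n → k < l → l < n → ∀ y,
      x i * y - a i = x j * y - a j → x k * y - a k = x l * y - a l → i = k ∧ j = l := by
  induction n with
  | zero => exact ⟨0, fun i j k l _ h => absurd h (Nat.not_lt_zero _)⟩
  | succ m ih =>
    obtain ⟨a, ha⟩ := ih (hx.mono fun i (hi : i < m) => Nat.lt_succ_of_lt hi)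
      fun k hk => hn k (Nat.lt_succ_of_lt hk)
    let Y : ℕ → ℕ → F := fun j l => (a j - a l) / (x j - x l)
    let T : Finset (Σ _ : ℕ, ℕ × ℕ) :=
      (range m).sigma fun l => range l ×ˢ (range m).erase l
    let f : (Σ _ : ℕ, ℕ × ℕ) → F := fun t =>
      x m * Y t.2.1 t.1 - (x t.2.2 * Y t.2.1 t.1 - a t.2.2)
    have hT : #T = (∑ l ∈ range m, l) * (m - 1) := by
      rw [Finset.card_sigma, Finset.sum_mul]
      refine Finset.sum_congr rfl fun l hl => ?_
      rw [Finset.card_product, Finset.card_erase_of_mem hl, card_range, card_range]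
    obtain ⟨c, hc⟩ : ∃ c, c ∉ T.image f := by
      by_contra! h
      have h1 : Fintype.card F ≤ #(T.image f) := by
        rw [Finset.eq_univ_of_forall h, Finset.card_univ]
      exact absurd (h1.trans (card_image_le.trans hT.le)) (not_le.2 (hn m (Nat.lt_succ_self m)))
    have apart_of_ne : ∀ j l i, j < l → l < m → i < m → i ≠ l → ∀ y,
        x j * y - a j = x l * y - a l → x i * y - a i ≠ x m * y - c := by
      intro j l i hjl hl hi hil y h1 h2
      have hne : x j - x l ≠ 0 := sub_ne_zero.2 fun h =>
        hjl.ne (hx (Set.mem_Iio.2 (by omega)) (Set.mem_Iio.2 (by omega)) h)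
      have hy : y = Y j l := by
        rw [eq_div_iff hne]; linear_combination h1
      refine hc (mem_image.2 ⟨⟨l, j, i⟩, ?_, ?_⟩)
      · simp [T, hjl, hl, hi, hil]
      · change x m * Y j l - (x i * Y j l - a i) = c
        rw [← hy]; linear_combination -h2
    have apart : ∀ j l i, j < l → l < m → i < m → ∀ y,
        x j * y - a j = x l * y - a l → x i * y - a i ≠ x m * y - c := by
      intro j l i hjl hl hi y h1 h2
      rcases eq_or_ne i l with rfl | hil
      · exact apart_of_ne j i j hjl hl (hjl.trans hl) hjl.ne y h1 (h1.trans h2)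
      · exact apart_of_ne j l i hjl hl hi hil y h1 h2
    refine ⟨Function.update a m c, fun i j k l hij hj hkl hl y h1 h2 => ?_⟩
    have hi : i ≠ m := by omega
    have hk : k ≠ m := by omega
    rcases eq_or_ne j m with hjm | hjm <;> rcases eq_or_ne l m with hlm | hlm
    · simp only [hjm, hlm, Function.update_self, Function.update_of_ne hi,
        Function.update_of_ne hk] at h1 h2
      refine ⟨?_, hjm.trans hlm.symm⟩
      rw [hjm] at hij
      rw [hlm] at hkl
      rcases lt_trichotomy i k with h | h | h
      · exact absurd h1 (apart i k i h hkl hij y (h1.trans h2.symm))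
      · exact h
      · exact absurd h1 (apart k i i h hij hij y (h2.trans h1.symm))
    · simp only [hjm, Function.update_self, Function.update_of_ne hi, Function.update_of_ne hk,
        Function.update_of_ne hlm] at h1 h2
      exact absurd h1 (apart k l i hkl (by omega) (by omega) y h2)
    · simp only [hlm, Function.update_self, Function.update_of_ne hi, Function.update_of_ne hk,
        Function.update_of_ne hjm] at h1 h2
      exact absurd h2 (apart i j k hij (by omega) (by omega) y h1)
    · simp only [Function.update_of_ne hi, Function.update_of_ne hk,
        Function.update_of_ne hjm, Function.update_of_ne hlm] at h1 h2
      exact ha i j k l hij (by omega) hkl (by omega) y h1 h2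

/-- Lower bound on the classical value of `CHSH_q(p)`: for `0 < p ≤ 1`,
`n = ⌈1/p⌉ ≥ 2` and `q > (n-1)((n-2)²/2 + 1)`, there are a `p`-bounded input
distribution `r` and a strategy `(a,b)` with
`ω(r,a,b) ≥ p + ((n-1)/q)(1 - np/2)`. -/
theorem chsh_lower_bound {F : Type*} [Field F] [Fintype F] [DecidableEq F]
    (q : ℕ) (hq : Fintype.card F = q)
    (p : ℝ) (hp0 : 0 < p) (hp1 : p ≤ 1)
    (n : ℕ) (hn : n = ⌈1 / p⌉₊) (hn2 : 2 ≤ n)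
    (hnq : ((n : ℝ) - 1) * (((n : ℝ) - 2) ^ 2 / 2 + 1) < q) :
    ∃ (r : F → ℝ) (a b : F → F),
      (∀ x, 0 ≤ r x) ∧ (∑ x : F, r x = 1) ∧ (∀ x, r x ≤ p) ∧
      p + ((n : ℝ) - 1) / q * (1 - n * p / 2) ≤ winProb q r a b := by
  obtain ⟨m, rfl⟩ : ∃ m, n = m + 1 := ⟨n - 1, by omega⟩
  have hm : 1 ≤ m := by omega
  have hmp : (m : ℝ) * p < 1 := by
    have : m < ⌈1 / p⌉₊ := by omega
    exact (lt_div_iff₀ hp0).1 (Nat.lt_ceil.1 this)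
  have hmp1 : 1 ≤ ((m : ℝ) + 1) * p := by
    have h : 1 / p ≤ ((m + 1 : ℕ) : ℝ) := hn ▸ Nat.le_ceil _
    push_cast at h
    exact (div_le_iff₀ hp0).1 h
  have hm1 : (1 : ℝ) ≤ m := by exact_mod_cast hm
  push_cast at hnq ⊢
  have hmq : m + 1 ≤ q := by
    have : (m : ℝ) < q := by nlinarith [sq_nonneg ((m : ℝ) + 1 - 2)]
    exact_mod_cast this
  have hq0 : (0 : ℝ) < q := by exact_mod_cast (by omega : 0 < q)
  let e : F ≃ Fin q := Fintype.equivFinOfCardEq hq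
  let idx : F → ℕ := fun t => e t
  let x : ℕ → F := fun i => if h : i < q then e.symm ⟨i, h⟩ else 0
  have hidx : ∀ t, x (idx t) = t := fun t => by simp [x, idx]
  have hsum : ∀ g : ℕ → ℝ, ∑ t, g (idx t) = ∑ i ∈ range q, g i := fun g => by
    rw [← Fin.sum_univ_eq_sum_range]
    exact e.sum_comp fun i : Fin q => g i
  have hxinj : Set.InjOn x (Set.Iio (m + 1)) := by
    intro i hi j hj h
    have hi' : i < q := lt_of_lt_of_le hi hmq
    have hj' : j < q := lt_of_lt_of_le hj hmq
    simpa [x, hi', hj'] using h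
  obtain ⟨a, ha⟩ := exists_intercepts_pairs_meet_apart x (m + 1) hxinj (by
    intro k hk
    rw [hq]
    rcases Nat.eq_zero_or_pos k with rfl | hk0
    · simp; omega
    obtain ⟨d, rfl⟩ : ∃ d, k = d + 1 := ⟨k - 1, by omega⟩
    have h2 : (((∑ l ∈ range (d + 1), l : ℕ)) : ℝ) * 2 = (d + 1) * d := by
      exact_mod_cast Finset.sum_range_id_mul_two (d + 1)
    have h3 : (d : ℝ) + 1 ≤ m := by exact_mod_cast Nat.lt_succ_iff.1 hk
    have h4 : (0 : ℝ) ≤ d := d.cast_nonneg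
    have h5 : (d : ℝ) ^ 2 ≤ ((m : ℝ) - 1) ^ 2 := pow_le_pow_left₀ h4 (by linarith) 2
    have h6 : ((d : ℝ) + 1) * (d : ℝ) ^ 2 ≤ m * ((m : ℝ) - 1) ^ 2 :=
      mul_le_mul h3 h5 (sq_nonneg _) (by linarith)
    have h7 : (((∑ l ∈ range (d + 1), l : ℕ)) : ℝ) * d < q := by
      have : (((∑ l ∈ range (d + 1), l : ℕ)) : ℝ) * d = ((d : ℝ) + 1) * (d : ℝ) ^ 2 / 2 := by
        linear_combination (d : ℝ) / 2 * h2
      rw [this]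
      nlinarith
    exact_mod_cast h7)
  let w : ℕ → ℝ := fun i => if i < m then p else if i = m then 1 - m * p else 0
  have hwlt : ∀ i < m, w i = p := fun i hi => by simp [w, hi]
  have hwm : w m = 1 - m * p := by simp [w]
  have hw0 : ∀ i, 0 ≤ w i := fun i => by
    dsimp only [w]; split_ifs <;> linarith
  have hwp : ∀ i, w i ≤ p := fun i => by
    dsimp only [w]; split_ifs <;> linarith
  have hw1 : ∑ i ∈ range q, w i = 1 := by
    rw [← Finset.sum_subset (Finset.range_mono hmq), Finset.sum_range_succ, hwm,
      Finset.sum_congr rfl fun i hi => hwlt i (mem_range.1 hi)]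
    · simp
    · intro i _ hi
      have : m + 1 ≤ i := by simpa using hi
      simp [w, show ¬ i < m by omega, show i ≠ m by omega]
  -- Bob follows a meeting pair of lines above `y` if there is one, and the first line otherwise.
  have hb : ∀ y : F, ∃ v : F,
      p + ∑ j ∈ range (m + 1), ∑ i ∈ range j,
        (if x i * y - a i = x j * y - a j then w j else 0) ≤
      ∑ i ∈ range q, w i * (if a i + v = x i * y then (1 : ℝ) else 0) := by
    intro y
    have hnn : ∀ v, ∀ i ∈ range q,
        0 ≤ w i * (if a i + v = x i * y then (1 : ℝ) else 0) := fun v i _ =>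
      mul_nonneg (hw0 i) (by split_ifs <;> norm_num)
    by_cases h : ∃ i j, i < j ∧ j < m + 1 ∧ x i * y - a i = x j * y - a j
    · obtain ⟨i, j, hij, hj, h⟩ := h
      refine ⟨x i * y - a i, ?_⟩
      have hpair : ∑ l ∈ range (m + 1), ∑ k ∈ range l,
          (if x k * y - a k = x l * y - a l then w l else 0) = w j := by
        rw [Finset.sum_eq_single_of_mem j (mem_range.2 hj),
          Finset.sum_eq_single_of_mem i (mem_range.2 hij), if_pos h]
        · exact fun k hk hki => if_neg fun hkl =>
            hki (ha i j k j hij hj (mem_range.1 hk) hj y h hkl).1.symm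
        · exact fun l hl hlj => Finset.sum_eq_zero fun k hk => if_neg fun hkl =>
            hlj (ha i j k l hij hj (mem_range.1 hk) (mem_range.1 hl) y h hkl).2.symm
      rw [hpair]
      refine le_trans (le_of_eq ?_) (Finset.sum_le_sum_of_subset_of_nonneg (s := {i, j}) ?_
        fun k hk _ => hnn _ k hk)
      · rw [Finset.sum_pair hij.ne, if_pos (by ring), if_pos (by rw [h]; ring),
          hwlt i (by omega)]
        ring
      · intro k hk
        rcases Finset.mem_insert.1 hk with rfl | hk
        · exact mem_range.2 (by omega)
        · rw [Finset.mem_singleton.1 hk]; exact mem_range.2 (by omega)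
    · push Not at h
      refine ⟨x 0 * y - a 0, ?_⟩
      rw [Finset.sum_eq_zero fun j hj => Finset.sum_eq_zero fun i hi =>
        if_neg (h i j (mem_range.1 hi) (mem_range.1 hj))]
      refine le_trans (le_of_eq ?_) (Finset.single_le_sum (hnn _)
        (mem_range.2 (by omega : 0 < q)))
      rw [if_pos (by ring), hwlt 0 hm]
      ring
  choose b hb using hb
  have hmeet : ∀ i j, i < j → j < m + 1 →
      w j ≤ ∑ y : F, (if x i * y - a i = x j * y - a j then w j else 0) := by
    intro i j hij hj
    have hne : x i - x j ≠ 0 := sub_ne_zero.2 fun h =>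
      hij.ne (hxinj (Set.mem_Iio.2 (by omega)) (Set.mem_Iio.2 hj) h)
    refine le_trans (le_of_eq ?_) (Finset.single_le_sum
      (fun y _ => by split_ifs; exacts [hw0 j, le_rfl])
      (Finset.mem_univ ((a i - a j) / (x i - x j))))
    rw [if_pos]
    field_simp
    ring
  have hgain : (m : ℝ) * (1 - (m + 1) * p / 2) = ∑ j ∈ range (m + 1), ∑ _i ∈ range j, w j := by
    have h2 : (∑ l ∈ range m, (l : ℝ)) * 2 = m * (m - 1) := by
      have := congrArg (Nat.cast : ℕ → ℝ) (Finset.sum_range_id_mul_two m)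
      push_cast [Nat.cast_sub hm] at this
      exact this
    simp only [Finset.sum_const, card_range, nsmul_eq_mul]
    rw [Finset.sum_range_succ, hwm,
      Finset.sum_congr rfl fun j hj => by rw [hwlt j (mem_range.1 hj)], ← Finset.sum_mul]
    linear_combination -p / 2 * h2
  refine ⟨fun t => w (idx t), fun t => a (idx t), b, fun t => hw0 _, (hsum w).trans hw1,
    fun t => hwp _, ?_⟩
  have hwin : (q : ℝ) * p + m * (1 - (m + 1) * p / 2) ≤
      ∑ t : F, ∑ y : F, w (idx t) * (if a (idx t) + b y = t * y then (1 : ℝ) else 0) := by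
    calc (q : ℝ) * p + m * (1 - (m + 1) * p / 2)
        ≤ (q : ℝ) * p + ∑ j ∈ range (m + 1), ∑ i ∈ range j, ∑ y : F,
            (if x i * y - a i = x j * y - a j then w j else 0) := by
          rw [hgain]
          gcongr with j hj i hi
          exact hmeet i j (mem_range.1 hi) (mem_range.1 hj)
      _ = ∑ y : F, (p + ∑ j ∈ range (m + 1), ∑ i ∈ range j,
            (if x i * y - a i = x j * y - a j then w j else 0)) := by
          rw [Finset.sum_add_distrib, Finset.sum_const, Finset.card_univ, hq, nsmul_eq_mul,
            Finset.sum_comm]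
          congr 1
          exact Finset.sum_congr rfl fun j _ => Finset.sum_comm
      _ ≤ ∑ y : F, ∑ i ∈ range q, w i * (if a i + b y = x i * y then (1 : ℝ) else 0) :=
          Finset.sum_le_sum fun y _ => hb y
      _ = _ := by
          rw [Finset.sum_comm (s := (Finset.univ : Finset F)) (t := (Finset.univ : Finset F))]
          refine Finset.sum_congr rfl fun y _ => ?_
          rw [← hsum]
          simp only [hidx]
  calc p + ((m : ℝ) + 1 - 1) / q * (1 - (m + 1) * p / 2)
      = 1 / (q : ℝ) * (q * p + m * (1 - (m + 1) * p / 2)) := by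
        field_simp
        ring
    _ ≤ _ := mul_le_mul_of_nonneg_left hwin (by positivity)
end

section
/- Let n ≥ 1 be a natural number and assume q > (n−1)·((n−2)²/2 + 1). Then there exists a set S ⊆ F² of n points such that any two distinct points of S have distinct first coordinates, and any two distinct (unordered) pairs of distinct points of S determine distinct slopes; in particular no three points of S are collinear. -/
open Finset

section PlaneSlopes

variable {F : Type*} [Field F]

/-- The slope of the line through two points of the plane `F × F`. -/
def planeSlope (p₁ p₂ : F × F) : F := (p₂.2 - p₁.2) / (p₂.1 - p₁.1)

theorem planeSlope_comm (p₁ p₂ : F × F) : planeSlope p₁ p₂ = planeSlope p₂ p₁ := by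
  rw [planeSlope, planeSlope, ← neg_sub p₁.2, ← neg_sub p₁.1, neg_div_neg_eq]

theorem planeSlope_eq_iff {p₁ p₂ : F × F} (h : p₁.1 ≠ p₂.1) (s : F) :
    planeSlope p₁ p₂ = s ↔ p₂.2 = p₁.2 + s * (p₂.1 - p₁.1) := by
  rw [planeSlope, div_eq_iff (sub_ne_zero.2 h.symm), sub_eq_iff_eq_add']

/-- If two lines through a common point have equal slopes, the third side of the triangle
has the same slope. -/
theorem planeSlope_eq_of_planeSlope_eq {c d p : F × F} (hc : c.1 ≠ p.1) (hd : d.1 ≠ p.1)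
    (hcd : c.1 ≠ d.1) (h : planeSlope c p = planeSlope d p) :
    planeSlope c p = planeSlope c d := by
  have h₁ := (planeSlope_eq_iff hc _).1 rfl
  have h₂ := (planeSlope_eq_iff hd _).1 h.symm
  symm
  rw [planeSlope_eq_iff hcd]
  linear_combination h₁ - h₂

/-- The points of `S` have distinct first coordinates, and distinct pairs of points of `S`
have distinct slopes. -/
def HasDistinctSlopes (S : Finset (F × F)) : Prop :=
  (∀ a ∈ S, ∀ b ∈ S, a ≠ b → a.1 ≠ b.1) ∧
    ∀ a ∈ S, ∀ b ∈ S, ∀ c ∈ S, ∀ d ∈ S, a ≠ b → c ≠ d →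
      planeSlope a b = planeSlope c d → (a = c ∧ b = d) ∨ (a = d ∧ b = c)

theorem HasDistinctSlopes.not_collinear {S : Finset (F × F)} (hS : HasDistinctSlopes S)
    {a b c : F × F} (ha : a ∈ S) (hb : b ∈ S) (hc : c ∈ S) (hab : a ≠ b) (hac : a ≠ c)
    (hbc : b ≠ c) : ¬ Collinear F ({a, b, c} : Set (F × F)) := by
  intro h
  obtain ⟨v, hv⟩ := (collinear_iff_of_mem (p₀ := a) (by simp)).1 h
  obtain ⟨r, rfl⟩ := hv b (by simp)
  obtain ⟨t, rfl⟩ := hv c (by simp)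
  have h₁ := hS.1 _ ha _ hb hab
  have h₂ := hS.1 _ ha _ hc hac
  have h₃ : planeSlope a (r • v +ᵥ a) = planeSlope a (t • v +ᵥ a) := by
    simp only [planeSlope, vadd_eq_add, Prod.fst_add, Prod.snd_add, Prod.smul_fst,
      Prod.smul_snd, smul_eq_mul, add_sub_cancel_right] at h₁ h₂ ⊢
    have hr : r ≠ 0 := by rintro rfl; simp at h₁
    have ht : t ≠ 0 := by rintro rfl; simp at h₂
    rw [mul_div_mul_left _ _ hr, mul_div_mul_left _ _ ht]
  rcases hS.2 _ ha _ hb _ ha _ hc hab hac h₃ with h | h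
  · exact hbc h.2
  · exact hac h.1

variable [DecidableEq F]

/-- The set of slopes determined by pairs of distinct points of `S`. -/
def planeSlopes (S : Finset (F × F)) : Finset F :=
  S.offDiag.image fun e => planeSlope e.1 e.2

theorem card_planeSlopes_le (S : Finset (F × F)) :
    (planeSlopes S).card ≤ S.card.choose 2 := by
  have h : planeSlopes S = (S.offDiag.image Sym2.mk.uncurry).image
      (Sym2.lift ⟨planeSlope, planeSlope_comm⟩) := by
    rw [image_image]
    rfl
  rw [h, ← Sym2.card_image_offDiag]
  exact card_image_le

/-- The ordinates, on the vertical line with abscissa `x`, of the lines through points of `S`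
having a slope determined by `S`. -/
def slopeOrdinates (S : Finset (F × F)) (x : F) : Finset F :=
  (planeSlopes S).biUnion fun s => S.image fun c => c.2 + s * (x - c.1)

theorem HasDistinctSlopes.card_slopeOrdinates_le {S : Finset (F × F)}
    (hS : HasDistinctSlopes S) (x : F) :
    (slopeOrdinates S x).card ≤ S.card.choose 2 * (S.card - 1) := by
  refine (card_biUnion_le_card_mul _ _ (S.card - 1) fun s hs => ?_).trans
    (Nat.mul_le_mul_right _ (card_planeSlopes_le S))
  obtain ⟨⟨a, b⟩, hab, rfl⟩ := mem_image.1 hs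
  obtain ⟨ha, hb, hne⟩ := mem_offDiag.1 hab
  refine Nat.le_sub_one_of_lt (lt_of_le_of_ne card_image_le fun h => hne ?_)
  refine card_image_iff.1 h ha hb ?_
  have := (planeSlope_eq_iff (hS.1 _ ha _ hb hne) _).1 rfl
  simp only
  linear_combination -this

theorem HasDistinctSlopes.insert_of_notMem {S : Finset (F × F)} (hS : HasDistinctSlopes S) {p : F × F}
    (hx : ∀ c ∈ S, c.1 ≠ p.1) (hy : p.2 ∉ slopeOrdinates S p.1) :
    HasDistinctSlopes (insert p S) := by
  have h₁ : ∀ c ∈ S, ∀ a ∈ S, ∀ b ∈ S, a ≠ b → planeSlope c p ≠ planeSlope a b := by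
    intro c hc a ha b hb hab h
    exact hy (mem_biUnion.2 ⟨planeSlope a b,
      mem_image.2 ⟨(a, b), mem_offDiag.2 ⟨ha, hb, hab⟩, rfl⟩,
      mem_image.2 ⟨c, hc, ((planeSlope_eq_iff (hx c hc) _).1 h).symm⟩⟩)
  have h₂ : ∀ c ∈ S, ∀ d ∈ S, planeSlope c p = planeSlope d p → c = d := by
    intro c hc d hd h
    by_contra hcd
    exact h₁ c hc c hc d hd hcd
      (planeSlope_eq_of_planeSlope_eq (hx c hc) (hx d hd) (hS.1 c hc d hd hcd) h)
  have h₃ := planeSlope_comm p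
  obtain ⟨hS₁, hS₂⟩ := hS
  constructor
  · intro a ha b hb hab
    rw [mem_insert] at ha hb
    rcases ha with rfl | ha <;> rcases hb with rfl | hb
    · exact absurd rfl hab
    · exact (hx b hb).symm
    · exact hx a ha
    · exact hS₁ a ha b hb hab
  · intro a ha b hb c hc d hd hab hcd h
    rw [mem_insert] at ha hb hc hd
    rcases ha with rfl | ha <;> rcases hb with rfl | hb <;>
      rcases hc with rfl | hc <;> rcases hd with rfl | hd <;>
      grind

theorem HasDistinctSlopes.exists_insert [Fintype F] {S : Finset (F × F)}
    (hS : HasDistinctSlopes S) (hx : S.card < Fintype.card F)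
    (hy : S.card.choose 2 * (S.card - 1) < Fintype.card F) :
    ∃ p ∉ S, HasDistinctSlopes (insert p S) := by
  obtain ⟨x, hx⟩ : ∃ x, x ∉ S.image Prod.fst := by
    by_contra! h
    have := card_image_le (s := S) (f := Prod.fst)
    rw [eq_univ_of_forall h, card_univ] at this
    omega
  obtain ⟨y, hy⟩ : ∃ y, y ∉ slopeOrdinates S x := by
    by_contra! h
    have := hS.card_slopeOrdinates_le x
    rw [eq_univ_of_forall h, card_univ] at this
    omega
  exact ⟨(x, y), fun h => hx (mem_image_of_mem Prod.fst h),
    hS.insert_of_notMem (fun c hc h => hx (mem_image.2 ⟨c, hc, h⟩)) hy⟩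

theorem exists_hasDistinctSlopes_card_eq [Fintype F] (m : ℕ) (hm : m < Fintype.card F)
    (hm' : m.choose 2 * (m - 1) < Fintype.card F) :
    ∀ k ≤ m + 1, ∃ S : Finset (F × F), S.card = k ∧ HasDistinctSlopes S := by
  intro k
  induction k with
  | zero => exact fun _ => ⟨∅, rfl, by simp [HasDistinctSlopes]⟩
  | succ k ih =>
    intro hk
    obtain ⟨S, rfl, hS⟩ := ih (by omega)
    have hle : S.card ≤ m := by omega
    obtain ⟨p, hp, hpS⟩ := hS.exists_insert (by omega)
      ((Nat.mul_le_mul (Nat.choose_le_choose 2 hle) (Nat.sub_le_sub_right hle 1)).trans_lt hm')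
    exact ⟨_, card_insert_of_notMem hp, hpS⟩

end PlaneSlopes


open Finset

/-- If `q > (n-1)((n-2)²/2 + 1)` then `F²` contains a set `S` of `n` points
such that any two distinct points of `S` have distinct first coordinates, any
two distinct pairs of distinct points of `S` determine distinct slopes, and in
particular no three points of `S` are collinear. -/
theorem exists_general_position_set {F : Type*} [Field F] [Fintype F] [DecidableEq F]
    (q : ℕ) (hq : Fintype.card F = q)
    (n : ℕ) (hn : 1 ≤ n)
    (hnq : ((n : ℝ) - 1) * (((n : ℝ) - 2) ^ 2 / 2 + 1) < q) :
    ∃ S : Finset (F × F), S.card = n ∧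
      (∀ p₁ ∈ S, ∀ p₂ ∈ S, p₁ ≠ p₂ → p₁.1 ≠ p₂.1) ∧
      (∀ p₁ ∈ S, ∀ p₂ ∈ S, ∀ p₃ ∈ S, ∀ p₄ ∈ S, p₁ ≠ p₂ → p₃ ≠ p₄ →
        ({p₁, p₂} : Finset (F × F)) ≠ {p₃, p₄} →
        (p₂.2 - p₁.2) / (p₂.1 - p₁.1) ≠ (p₄.2 - p₃.2) / (p₄.1 - p₃.1)) ∧
      (∀ p₁ ∈ S, ∀ p₂ ∈ S, ∀ p₃ ∈ S, p₁ ≠ p₂ → p₁ ≠ p₃ → p₂ ≠ p₃ →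
        ¬ Collinear F ({p₁, p₂, p₃} : Set (F × F))) := by
  obtain ⟨m, rfl⟩ := Nat.exists_eq_add_of_le' hn
  subst hq
  push_cast at hnq
  have hm : m < Fintype.card F := by
    have : (m : ℝ) < Fintype.card F := by
      nlinarith [mul_nonneg (Nat.cast_nonneg (α := ℝ) m) (sq_nonneg ((m : ℝ) - 1))]
    exact_mod_cast this
  have hm' : m.choose 2 * (m - 1) < Fintype.card F := by
    rcases m with _ | m
    · simpa using hm
    have : (((m + 1).choose 2 * m : ℕ) : ℝ) < Fintype.card F := by
      push_cast [Nat.cast_choose_two] at hnq ⊢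
      nlinarith
    exact_mod_cast this
  obtain ⟨S, hcard, hS⟩ := exists_hasDistinctSlopes_card_eq m hm hm' (m + 1) le_rfl
  refine ⟨S, hcard, hS.1, ?_, fun a ha b hb c hc => hS.not_collinear ha hb hc⟩
  intro a ha b hb c hc d hd hab hcd hne h
  rcases hS.2 a ha b hb c hc d hd hab hcd h with ⟨rfl, rfl⟩ | ⟨rfl, rfl⟩
  · exact hne rfl
  · exact hne (pair_comm _ _)
end

section
/- Let S ⊆ F² be a set of m ≥ 1 points such that any two distinct points of S have distinct first coordinates and any two distinct (unordered) pairs of distinct points of S determine distinct slopes. If q > m + m·(m−1)²/2, then there exists a point p' ∈ F² \ S such that the set S ∪ {p'} again has the property that any two distinct points have distinct first coordinates and any two distinct pairs of distinct points determine distinct slopes. -/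
open Finset

/-- Pairwise distinctness of the values of a symmetric function on unordered pairs extends to
`insert p S` once the values on the new pairs avoid each other and the old values. -/
theorem pair_values_ne_insert {α β : Type*} [DecidableEq α] (σ : α → α → β)
    (hσ : ∀ a b, σ a b = σ b a) (S : Finset α) (p : α)
    (hS : ∀ a ∈ S, ∀ b ∈ S, ∀ c ∈ S, ∀ d ∈ S, a ≠ b → c ≠ d →
      ({a, b} : Finset α) ≠ {c, d} → σ a b ≠ σ c d)
    (hp_old : ∀ a ∈ S, ∀ b ∈ S, ∀ c ∈ S, a ≠ b → σ p c ≠ σ a b)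
    (hp_new : ∀ a ∈ S, ∀ b ∈ S, a ≠ b → σ p a ≠ σ p b) :
    ∀ a ∈ insert p S, ∀ b ∈ insert p S, ∀ c ∈ insert p S, ∀ d ∈ insert p S,
      a ≠ b → c ≠ d → ({a, b} : Finset α) ≠ {c, d} → σ a b ≠ σ c d := by
  intro a ha b hb c hc d hd hab hcd hne
  rw [mem_insert] at ha hb hc hd
  rcases ha with rfl | ha <;> rcases hb with rfl | hb <;> rcases hc with rfl | hc <;>
    rcases hd with rfl | hd <;>
      grind [Finset.pair_comm]

/-- If `#S * (#S - 1) ^ 2 < 2 * q`, then on each vertical line there is a point off all lines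
through a point of `S` parallel to a line joining two points of `S`. -/
theorem exists_not_mem_parallel_lines {F : Type*} [Field F] [Fintype F] [DecidableEq F]
    (S : Finset (F × F)) (hx : ∀ a ∈ S, ∀ b ∈ S, a ≠ b → a.1 ≠ b.1)
    (hcard : #S * (#S - 1) ^ 2 < Fintype.card F * 2) (x : F) :
    ∃ y : F, ∀ a ∈ S, ∀ b ∈ S, ∀ c ∈ S, a ≠ b →
      c.2 + (b.2 - a.2) / (b.1 - a.1) * (x - c.1) ≠ y := by
  let T : Finset (Σ _ : F × F, (F × F) × (F × F)) := S.sigma fun a => S.erase a ×ˢ S.erase a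
  let g : (Σ _ : F × F, (F × F) × (F × F)) → F := fun t =>
    t.2.2.2 + (t.2.1.2 - t.1.2) / (t.2.1.1 - t.1.1) * (x - t.2.2.1)
  have hT : #T = #S * (#S - 1) ^ 2 := by
    simp only [T, card_sigma, card_product]
    rw [sum_congr rfl fun a ha => by rw [card_erase_of_mem ha], sum_const, smul_eq_mul, sq]
  obtain ⟨y, -, hy⟩ := exists_card_fiber_lt_of_card_lt_mul (s := T) (t := univ) (f := g) (n := 2)
    (by rwa [hT, card_univ])
  refine ⟨y, fun a ha b hb c hc hab h => ?_⟩
  have hfib : ∀ t ∈ T, ∀ u ∈ T, g t = y → g u = y → t = u := fun t ht u hu hgt hgu =>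
    card_le_one.1 (Nat.lt_succ_iff.1 hy) t (by simp [ht, hgt]) u (by simp [hu, hgu])
  have hsymm : (a.2 - b.2) / (a.1 - b.1) = (b.2 - a.2) / (b.1 - a.1) := by
    rw [← neg_sub b.2, ← neg_sub b.1, neg_div_neg_eq]
  have hline : a.2 + (b.2 - a.2) / (b.1 - a.1) * (x - a.1) =
      b.2 + (b.2 - a.2) / (b.1 - a.1) * (x - b.1) := by
    have : b.1 - a.1 ≠ 0 := sub_ne_zero.2 (hx b hb a ha hab.symm)
    field_simp
    ring
  by_cases hcab : c = a ∨ c = b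
  · have hb' : b.2 + (b.2 - a.2) / (b.1 - a.1) * (x - b.1) = y := by
      rcases hcab with rfl | rfl
      · rwa [← hline]
      · exact h
    have := hfib ⟨a, b, b⟩ (by simp [T, ha, hb, hab.symm]) ⟨b, a, a⟩ (by simp [T, ha, hb, hab])
      hb' (by simp only [g]; rw [hsymm, hline, hb'])
    exact hab (congrArg Sigma.fst this)
  · rw [not_or] at hcab
    have := hfib ⟨a, b, c⟩ (by simp [T, ha, hb, hc, hab.symm, hcab.1])
      ⟨b, a, c⟩ (by simp [T, ha, hb, hc, hab, hcab.2]) h (by simp only [g]; rw [hsymm, h])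
    exact hab (congrArg Sigma.fst this)

/-- If `S ⊆ F²` is a set of `m ≥ 1` points with pairwise distinct first
coordinates whose pairs of distinct points determine pairwise distinct slopes,
and `q > m + m(m-1)²/2`, then a point `p' ∉ S` can be added to `S` preserving
both properties. -/
theorem extend_general_position_set {F : Type*} [Field F] [Fintype F] [DecidableEq F]
    (q : ℕ) (hq : Fintype.card F = q)
    (S : Finset (F × F)) (m : ℕ) (hm : S.card = m) (hm1 : 1 ≤ m)
    (hx : ∀ p₁ ∈ S, ∀ p₂ ∈ S, p₁ ≠ p₂ → p₁.1 ≠ p₂.1)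
    (hs : ∀ p₁ ∈ S, ∀ p₂ ∈ S, ∀ p₃ ∈ S, ∀ p₄ ∈ S, p₁ ≠ p₂ → p₃ ≠ p₄ →
      ({p₁, p₂} : Finset (F × F)) ≠ {p₃, p₄} →
      (p₂.2 - p₁.2) / (p₂.1 - p₁.1) ≠ (p₄.2 - p₃.2) / (p₄.1 - p₃.1))
    (hq2 : (m : ℝ) + m * ((m : ℝ) - 1) ^ 2 / 2 < q) :
    ∃ p' : F × F, p' ∉ S ∧
      (∀ p₁ ∈ insert p' S, ∀ p₂ ∈ insert p' S, p₁ ≠ p₂ → p₁.1 ≠ p₂.1) ∧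
      (∀ p₁ ∈ insert p' S, ∀ p₂ ∈ insert p' S, ∀ p₃ ∈ insert p' S, ∀ p₄ ∈ insert p' S,
        p₁ ≠ p₂ → p₃ ≠ p₄ → ({p₁, p₂} : Finset (F × F)) ≠ {p₃, p₄} →
        (p₂.2 - p₁.2) / (p₂.1 - p₁.1) ≠ (p₄.2 - p₃.2) / (p₄.1 - p₃.1)) := by
  subst hq hm
  have hmR : ((#S - 1 : ℕ) : ℝ) = (#S : ℝ) - 1 := by push_cast [Nat.cast_sub hm1]; rfl
  have hcard : #S * (#S - 1) ^ 2 < Fintype.card F * 2 := by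
    have : (#S : ℝ) * ((#S - 1 : ℕ) : ℝ) ^ 2 < Fintype.card F * 2 := by
      rw [hmR]
      linarith [Nat.cast_nonneg (α := ℝ) #S]
    exact_mod_cast this
  have hlt : #(S.image Prod.fst) < Fintype.card F := by
    have : (#S : ℝ) < Fintype.card F := by
      have : 0 ≤ (#S : ℝ) * ((#S : ℝ) - 1) ^ 2 / 2 := by positivity
      linarith
    exact card_image_le.trans_lt (by exact_mod_cast this)
  obtain ⟨x, -, hxS⟩ := exists_mem_notMem_of_card_lt_card (hlt.trans_eq card_univ.symm)
  obtain ⟨y, hy⟩ := exists_not_mem_parallel_lines S hx hcard x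
  have hx' : ∀ a ∈ S, a.1 ≠ x := fun a ha h => hxS (mem_image.2 ⟨a, ha, h⟩)
  have hp_old : ∀ a ∈ S, ∀ b ∈ S, ∀ c ∈ S, a ≠ b →
      (c.2 - y) / (c.1 - x) ≠ (b.2 - a.2) / (b.1 - a.1) := by
    intro a ha b hb c hc hab h
    apply hy a ha b hb c hc hab
    rw [← h]
    have : c.1 - x ≠ 0 := sub_ne_zero.2 (hx' c hc)
    field_simp
    ring
  refine ⟨(x, y), fun h => hx' _ h rfl, ?_, ?_⟩
  · intro a ha b hb hab
    rcases mem_insert.1 ha with rfl | ha <;> rcases mem_insert.1 hb with rfl | hb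
    · exact absurd rfl hab
    · exact (hx' b hb).symm
    · exact hx' a ha
    · exact hx a ha b hb hab
  · refine pair_values_ne_insert (fun a b : F × F => (b.2 - a.2) / (b.1 - a.1))
      (fun a b => ?_) S (x, y) hs hp_old fun a ha b hb hab h => ?_
    · rw [← neg_sub a.2, ← neg_sub a.1, neg_div_neg_eq]
    · apply hp_old a ha b hb a ha hab
      have h₁ : a.1 - x ≠ 0 := sub_ne_zero.2 (hx' a ha)
      have h₂ : b.1 - x ≠ 0 := sub_ne_zero.2 (hx' b hb)
      have h₃ : b.1 - a.1 ≠ 0 := sub_ne_zero.2 (hx b hb a ha hab.symm)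
      simp only at h
      rw [div_eq_div_iff h₁ h₂] at h
      rw [div_eq_div_iff h₁ h₃]
      linear_combination h
end

section
/- Let 0 < p ≤ 1, n = ⌈1/p⌉ with n ≥ 2, and assume q > (n−1)·((n−2)²/2 + 1). Then the supremum, over all p-bounded input distributions r and all strategies (a,b), of the winning probability ω(r,a,b) equals p + ((n−1)/q)·(1 − n·p/2), and this supremum is attained. -/
open Finset

/-- A finset all of whose sums of two distinct elements are distinct. -/
def IsWeakSidon {F : Type*} [Add F] (T : Finset F) : Prop :=
  ∀ u ∈ T, ∀ v ∈ T, ∀ w ∈ T, ∀ z ∈ T, u ≠ v → w ≠ z → u + v = w + z →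
    (u = w ∧ v = z) ∨ (u = z ∧ v = w)

lemma IsWeakSidon.exists_insert {F : Type*} [Field F] [Fintype F] [DecidableEq F]
    {T : Finset F} (hT : IsWeakSidon T)
    (hcard : T.card + T.card.choose 2 * (T.card - 2) < Fintype.card F) :
    ∃ x, x ∉ T ∧ IsWeakSidon (insert x T) := by
  set B : Finset F := T ∪ (T.powersetCard 2).biUnion
    (fun P => (T \ P).image (fun z => ∑ i ∈ P, i - z)) with hB
  have hBcard : B.card < Fintype.card F := by
    refine lt_of_le_of_lt ((card_union_le _ _).trans ?_) hcard
    gcongr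
    rw [← card_powersetCard]
    refine card_biUnion_le_card_mul _ _ _ fun P hP => ?_
    rw [mem_powersetCard] at hP
    rw [← hP.2, ← card_sdiff_of_subset hP.1]
    exact card_image_le
  obtain ⟨x, hx⟩ : ∃ x, x ∉ B := by
    by_contra! h
    rw [eq_univ_iff_forall.2 h, card_univ] at hBcard
    exact lt_irrefl _ hBcard
  rw [hB, mem_union, not_or] at hx
  obtain ⟨hxT, hx⟩ := hx
  have key : ∀ z ∈ T, ∀ u ∈ T, ∀ v ∈ T, u ≠ v → x + z ≠ u + v := by
    intro z hz u hu v hv huv h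
    have hzu : z ≠ u := by
      rintro rfl
      exact hxT ((by linear_combination h : x = v) ▸ hv)
    have hzv : z ≠ v := by
      rintro rfl
      exact hxT ((by linear_combination h : x = u) ▸ hu)
    refine hx (mem_biUnion.2 ⟨{u, v}, ?_, mem_image.2 ⟨z, ?_, ?_⟩⟩)
    · rw [mem_powersetCard, card_pair huv]
      exact ⟨by simp [insert_subset_iff, hu, hv], rfl⟩
    · simp [hz, hzu, hzv]
    · rw [sum_pair huv]
      linear_combination -h
  refine ⟨x, hxT, ?_⟩
  intro u hu v hv w hw z hz huv hwz h
  rw [mem_insert] at hu hv hw hz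
  rcases hu with rfl | hu <;> rcases hv with rfl | hv <;> rcases hw with rfl | hw <;>
    rcases hz with rfl | hz
  all_goals first
    | exact hT u hu v hv w hw z hz huv hwz h
    | grind

lemma exists_isWeakSidon_card {F : Type*} [Field F] [Fintype F] [DecidableEq F] (n : ℕ)
    (hn : (n - 1) + (n - 1).choose 2 * (n - 1 - 2) < Fintype.card F) :
    ∃ T : Finset F, IsWeakSidon T ∧ T.card = n := by
  suffices H : ∀ m ≤ n, ∃ T : Finset F, IsWeakSidon T ∧ T.card = m from H n le_rfl
  intro m
  induction m with
  | zero => exact fun _ => ⟨∅, by simp [IsWeakSidon], rfl⟩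
  | succ m ih =>
    intro hm
    obtain ⟨T, hT, hTm⟩ := ih (by omega)
    have hm' : m ≤ n - 1 := by omega
    obtain ⟨x, hx, hxT⟩ := hT.exists_insert (by
      rw [hTm]
      refine lt_of_le_of_lt ?_ hn
      gcongr)
    exact ⟨_, hxT, by rw [card_insert_of_notMem hx, hTm]⟩

lemma sum_offDiag_add {α : Type*} [DecidableEq α] (T : Finset α) (f : α → ℝ) :
    ∑ z ∈ T.offDiag, (f z.1 + f z.2) = 2 * ((T.card : ℝ) - 1) * ∑ x ∈ T, f x := by
  have h := sum_union (disjoint_diag_offDiag T) (f := fun z : α × α => f z.1 + f z.2)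
  rw [diag_union_offDiag, sum_product, sum_diag] at h
  simp only [sum_add_distrib, sum_const, nsmul_eq_mul, ← mul_sum] at h
  rw [sum_add_distrib]
  linear_combination -h

lemma exists_card_eq_forall_le {α : Type*} [Fintype α] [DecidableEq α] (d : α → ℝ) (k : ℕ)
    (hk : k < Fintype.card α) :
    ∃ (S : Finset α) (t : α), S.card = k ∧ t ∉ S ∧ (∀ x ∈ S, d t ≤ d x) ∧
      ∀ x ∉ S, d x ≤ d t := by
  have hmax : ∀ S : Finset α, S.card < Fintype.card α → ∃ t ∉ S, ∀ x ∉ S, d x ≤ d t := by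
    intro S hS
    have hne : Sᶜ.Nonempty := by
      rw [← card_pos, card_compl]
      omega
    simpa using exists_max_image Sᶜ d hne
  induction k with
  | zero =>
    obtain ⟨t, ht, h⟩ := hmax ∅ (by simpa using hk)
    exact ⟨∅, t, rfl, ht, by simp, h⟩
  | succ k ih =>
    obtain ⟨S, t, hS, ht, h1, h2⟩ := ih (by omega)
    have hc : (insert t S).card = k + 1 := by rw [card_insert_of_notMem ht, hS]
    obtain ⟨u, hu, h⟩ := hmax (insert t S) (by omega)
    have hut : d u ≤ d t := h2 u fun hS => hu (mem_insert_of_mem hS)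
    refine ⟨insert t S, u, hc, hu, ?_, h⟩
    intro x hx
    rcases mem_insert.1 hx with rfl | hx
    · exact hut
    · exact hut.trans (h1 x hx)

/-- A `p`-bounded distribution puts at most as much weight on `d` as the greedy one. -/
lemma sum_mul_le_of_bounded {α : Type*} [Fintype α] [DecidableEq α] {r d : α → ℝ} {p : ℝ}
    (hr0 : ∀ x, 0 ≤ r x) (hr1 : ∑ x, r x = 1) (hrp : ∀ x, r x ≤ p) {S : Finset α} {t : α}
    (hS : ∀ x ∈ S, d t ≤ d x) (hSc : ∀ x ∉ S, d x ≤ d t) :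
    ∑ x, r x * d x ≤ p * ∑ x ∈ S, d x + (1 - p * S.card) * d t := by
  have h : ∑ x, r x * (d x - d t) ≤ ∑ x ∈ S, p * (d x - d t) := by
    rw [← sum_add_sum_compl S]
    have h1 : ∑ x ∈ S, r x * (d x - d t) ≤ ∑ x ∈ S, p * (d x - d t) :=
      sum_le_sum fun x hx => mul_le_mul_of_nonneg_right (hrp x) (sub_nonneg.2 (hS x hx))
    have h2 : ∑ x ∈ Sᶜ, r x * (d x - d t) ≤ 0 :=
      sum_nonpos fun x hx => mul_nonpos_of_nonneg_of_nonpos (hr0 x)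
        (sub_nonpos.2 (hSc x (mem_compl.1 hx)))
    linarith
  simp only [mul_sub, sum_sub_distrib, ← sum_mul, ← mul_sum, hr1, sum_const, nsmul_eq_mul] at h
  linarith

/-- Inclusion-exclusion bound on the number of incidences between the points `(x, a x)`, `x ∈ T`,
and the lines of slope `y` and intercept `-b y`. -/
lemma two_mul_sum_card_filter_le {F : Type*} [Field F] [Fintype F] [DecidableEq F] (a b : F → F)
    (T : Finset F) :
    2 * ∑ x ∈ T, ((#{y : F | a x + b y = x * y} : ℕ) : ℝ) ≤
      2 * Fintype.card F + T.card * ((T.card : ℝ) - 1) := by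
  have hswap : ∑ x ∈ T, #{y : F | a x + b y = x * y} =
      ∑ y : F, #{x ∈ T | a x + b y = x * y} := by
    simp only [card_filter]
    exact sum_comm
  have hdisj : ∑ y : F, #{x ∈ T | a x + b y = x * y}.offDiag ≤ #T.offDiag := by
    rw [← card_biUnion]
    · refine card_le_card fun z hz => ?_
      simp only [mem_biUnion, mem_offDiag, mem_filter] at hz ⊢
      obtain ⟨y, -, hz⟩ := hz
      exact ⟨hz.1.1, hz.2.1.1, hz.2.2⟩
    · intro y _ y' _ hyy'
      refine disjoint_left.2 fun z hz hz' => hyy' ?_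
      simp only [mem_offDiag, mem_filter] at hz hz'
      refine mul_left_cancel₀ (sub_ne_zero.2 hz.2.2) ?_
      linear_combination hz.2.1.2 - hz.1.2 + hz'.1.2 - hz'.2.1.2
  have hoff : ∀ S : Finset F, ((#S.offDiag : ℕ) : ℝ) = #S * ((#S : ℝ) - 1) := by
    intro S
    rw [offDiag_card, Nat.cast_sub (Nat.le_mul_self _)]
    push_cast
    ring
  have hk : ∀ k : ℕ, 2 * (k : ℝ) ≤ 2 + k * ((k : ℝ) - 1) := by
    intro k
    have h : (k : ℝ) ≤ 1 ∨ (2 : ℝ) ≤ k := by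
      rcases Nat.lt_or_ge k 2 with h | h
      · exact Or.inl (by exact_mod_cast (by omega : k ≤ 1))
      · exact Or.inr (by exact_mod_cast h)
    rcases h with h | h <;> nlinarith
  have hdisj' : ∑ y : F, ((#{x ∈ T | a x + b y = x * y}.offDiag : ℕ) : ℝ) ≤ #T.offDiag := by
    exact_mod_cast hdisj
  rw [← Nat.cast_sum, hswap, Nat.cast_sum, mul_sum, ← hoff T]
  calc ∑ y : F, 2 * ((#{x ∈ T | a x + b y = x * y} : ℕ) : ℝ)
      ≤ ∑ y : F, (2 + ((#{x ∈ T | a x + b y = x * y}.offDiag : ℕ) : ℝ)) :=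
        sum_le_sum fun y _ => by rw [hoff]; exact hk _
    _ ≤ _ := by
        rw [sum_add_distrib, sum_const, card_univ, nsmul_eq_mul, mul_comm]
        linarith

lemma winProb_eq_sum_mul_card {F : Type*} [Field F] [Fintype F] [DecidableEq F]
    (q : ℕ) (r : F → ℝ) (a b : F → F) :
    winProb q r a b = 1 / q * ∑ x, r x * ((#{y : F | a x + b y = x * y} : ℕ) : ℝ) := by
  simp only [winProb, ← mul_sum, sum_boole]

lemma winProb_eq_sum_sum_filter {F : Type*} [Field F] [Fintype F] [DecidableEq F]
    (q : ℕ) (r : F → ℝ) (a b : F → F) :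
    winProb q r a b = 1 / q * ∑ y, ∑ x with a x + b y = x * y, r x := by
  rw [winProb, sum_comm]
  simp only [mul_ite, mul_one, mul_zero, sum_filter]

lemma winProb_le {F : Type*} [Field F] [Fintype F] [DecidableEq F]
    {n : ℕ} {p : ℝ} (hn : 1 ≤ n) (hnq : n ≤ Fintype.card F)
    (hp1 : ((n : ℝ) - 1) * p ≤ 1) (hp2 : 1 ≤ n * p)
    {r : F → ℝ} (a b : F → F) (hr0 : ∀ x, 0 ≤ r x) (hr1 : ∑ x, r x = 1) (hrp : ∀ x, r x ≤ p) :
    winProb (Fintype.card F) r a b ≤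
      p + ((n : ℝ) - 1) / Fintype.card F * (1 - n * p / 2) := by
  obtain ⟨S, t, hS, ht, h1, h2⟩ := exists_card_eq_forall_le
    (fun x => ((#{y : F | a x + b y = x * y} : ℕ) : ℝ)) (n - 1) (by omega)
  have hmain := sum_mul_le_of_bounded hr0 hr1 hrp h1 h2
  have hq : (0 : ℝ) < Fintype.card F := by exact_mod_cast Fintype.card_pos
  have hA := two_mul_sum_card_filter_le a b S
  have hB := two_mul_sum_card_filter_le a b (insert t S)
  rw [sum_insert ht, card_insert_of_notMem ht] at hB
  rw [hS] at hA hB hmain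
  rw [Nat.sub_add_cancel hn] at hB
  rw [Nat.cast_sub hn, Nat.cast_one] at hA hmain
  rw [winProb_eq_sum_mul_card, one_div_mul_eq_div, div_le_iff₀ hq]
  refine hmain.trans ?_
  have hA' := mul_le_mul_of_nonneg_left hA (sub_nonneg.2 hp2)
  have hB' := mul_le_mul_of_nonneg_left hB (sub_nonneg.2 hp1)
  have : (p + ((n : ℝ) - 1) / Fintype.card F * (1 - n * p / 2)) * Fintype.card F =
      p * Fintype.card F + (n - 1) * (1 - n * p / 2) := by
    field_simp
  rw [this]
  linarith

lemma exists_le_winProb {F : Type*} [Field F] [Fintype F] [DecidableEq F]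
    {n : ℕ} {p : ℝ} (hn : 2 ≤ n) (hp0 : 0 ≤ p)
    (hp1 : ((n : ℝ) - 1) * p ≤ 1) (hp2 : 1 ≤ n * p) {T : Finset F} (hT : IsWeakSidon T)
    (hTn : #T = n) :
    ∃ (r : F → ℝ) (a b : F → F), (∀ x, 0 ≤ r x) ∧ (∑ x, r x = 1) ∧ (∀ x, r x ≤ p) ∧
      p + ((n : ℝ) - 1) / Fintype.card F * (1 - n * p / 2) ≤
        winProb (Fintype.card F) r a b := by
  obtain ⟨t, ht⟩ : T.Nonempty := card_pos.1 (by omega)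
  obtain ⟨c, hc, hct⟩ := exists_mem_ne (by omega : 1 < #T) t
  set r : F → ℝ := fun x => if x ∈ T then (if x = t then 1 - (n - 1) * p else p) else 0 with hr
  have hr0 : ∀ x, 0 ≤ r x := by
    intro x
    simp only [hr]
    split_ifs <;> linarith
  have hrp : ∀ x, r x ≤ p := by
    intro x
    simp only [hr]
    split_ifs <;> linarith
  have hrT : ∀ x ∈ T, x ≠ t → r x = p := fun x hx hxt => by simp [hr, hx, hxt]
  have hsumT : ∑ x ∈ T, r x = 1 := by
    rw [← add_sum_erase T r ht, sum_congr rfl fun x hx =>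
      hrT x (mem_of_mem_erase hx) (ne_of_mem_erase hx), sum_const, card_erase_of_mem ht, hTn,
      nsmul_eq_mul, Nat.cast_sub (by omega)]
    simp [hr, ht]
  have hsum : ∑ x, r x = 1 := by
    rw [← hsumT]
    exact (sum_subset (subset_univ T) fun x _ hx => by simp [hr, hx]).symm
  have hb : ∀ y : F, ∃ β : F, p ≤ ∑ x with x ^ 2 + β = x * y, r x ∧
      ∀ u ∈ T, ∀ v ∈ T, u ≠ v → u + v = y → r u + r v ≤ ∑ x with x ^ 2 + β = x * y, r x := by
    intro y
    by_cases h : ∃ u ∈ T, ∃ v ∈ T, u ≠ v ∧ u + v = y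
    · obtain ⟨u, hu, v, hv, huv, rfl⟩ := h
      have hle : r u + r v ≤ ∑ x with x ^ 2 + u * v = x * (u + v), r x := by
        rw [← sum_pair huv]
        refine sum_le_sum_of_subset_of_nonneg ?_ fun x _ _ => hr0 x
        intro x hx
        simp only [mem_insert, mem_singleton] at hx
        rw [mem_filter]
        refine ⟨mem_univ _, ?_⟩
        rcases hx with rfl | rfl <;> ring
      refine ⟨u * v, le_trans ?_ hle, ?_⟩
      · by_cases hut : u = t
        · linarith [hr0 u, hrT v hv (hut ▸ huv.symm)]
        · linarith [hr0 v, hrT u hu hut]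
      · intro u' hu' v' hv' huv' h
        rcases hT u' hu' v' hv' u hu v hv huv' huv h with ⟨rfl, rfl⟩ | ⟨rfl, rfl⟩
        · exact hle
        · rwa [add_comm (r u')]
    · refine ⟨c * y - c ^ 2, ?_, fun u hu v hv huv hy => (h ⟨u, hu, v, hv, huv, hy⟩).elim⟩
      rw [← hrT c hc hct]
      exact single_le_sum (fun x _ => hr0 x) (by simp)
  choose b hb1 hb2 using hb
  refine ⟨r, fun x => x ^ 2, b, hr0, hsum, hrp, ?_⟩
  have hq : (0 : ℝ) < Fintype.card F := by exact_mod_cast Fintype.card_pos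
  set W : F → ℝ := fun y => ∑ x with x ^ 2 + b y = x * y, r x with hW
  have hfib : ∀ y : F, #{z ∈ T.offDiag | z.1 + z.2 = y} ≤ 2 := by
    intro y
    rcases eq_empty_or_nonempty {z ∈ T.offDiag | z.1 + z.2 = y} with h | ⟨z, hz⟩
    · simp [h]
    · refine (card_le_card fun w hw => ?_).trans (card_le_two (a := z) (b := (z.2, z.1)))
      simp only [mem_filter, mem_offDiag] at hz hw
      simp only [mem_insert, mem_singleton, Prod.ext_iff]
      exact hT _ hw.1.1 _ hw.1.2.1 _ hz.1.1 _ hz.1.2.1 hw.1.2.2 hz.1.2.2 (hw.2.trans hz.2.symm)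
  have hpairs : ∑ z ∈ T.offDiag, (r z.1 + r z.2 - p) ≤ 2 * ∑ y, (W y - p) := by
    calc ∑ z ∈ T.offDiag, (r z.1 + r z.2 - p)
        ≤ ∑ z ∈ T.offDiag, (W (z.1 + z.2) - p) := sum_le_sum fun z hz => by
          rw [mem_offDiag] at hz
          exact sub_le_sub_right (hb2 _ _ hz.1 _ hz.2.1 hz.2.2 rfl) _
      _ = ∑ y, #{z ∈ T.offDiag | z.1 + z.2 = y} * (W y - p) := by
          rw [← sum_fiberwise T.offDiag (fun z => z.1 + z.2)]
          refine sum_congr rfl fun y _ => ?_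
          rw [← nsmul_eq_mul, ← sum_const]
          exact sum_congr rfl fun z hz => by rw [(mem_filter.1 hz).2]
      _ ≤ ∑ y, 2 * (W y - p) := sum_le_sum fun y _ =>
          mul_le_mul_of_nonneg_right (by exact_mod_cast hfib y) (sub_nonneg.2 (hb1 y))
      _ = _ := (mul_sum _ _ _).symm
  rw [sum_sub_distrib, sum_offDiag_add, hsumT, sum_const, offDiag_card, hTn, nsmul_eq_mul,
    Nat.cast_sub (Nat.le_mul_self n), sum_sub_distrib, sum_const, card_univ, nsmul_eq_mul] at hpairs
  push_cast at hpairs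
  rw [winProb_eq_sum_sum_filter, one_div_mul_eq_div, le_div_iff₀ hq]
  have : (p + ((n : ℝ) - 1) / Fintype.card F * (1 - n * p / 2)) * Fintype.card F =
      p * Fintype.card F + (n - 1) * (1 - n * p / 2) := by
    field_simp
  rw [this]
  linarith

/-- Tight bound on the classical value of `CHSH_q(p)`: for `0 < p ≤ 1`,
`n = ⌈1/p⌉ ≥ 2` and `q > (n-1)((n-2)²/2 + 1)`, the supremum of the winning
probabilities `ω(r,a,b)` over all `p`-bounded input distributions `r` and all
strategies `(a,b)` equals `p + ((n-1)/q)(1 - np/2)` and is attained. -/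
theorem chsh_classical_value {F : Type*} [Field F] [Fintype F] [DecidableEq F]
    (q : ℕ) (hq : Fintype.card F = q)
    (p : ℝ) (hp0 : 0 < p) (hp1 : p ≤ 1)
    (n : ℕ) (hn : n = ⌈1 / p⌉₊) (hn2 : 2 ≤ n)
    (hnq : ((n : ℝ) - 1) * (((n : ℝ) - 2) ^ 2 / 2 + 1) < q) :
    IsGreatest {w : ℝ | ∃ (r : F → ℝ) (a b : F → F),
        (∀ x, 0 ≤ r x) ∧ (∑ x : F, r x = 1) ∧ (∀ x, r x ≤ p) ∧ winProb q r a b = w}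
      (p + ((n : ℝ) - 1) / q * (1 - n * p / 2)) := by
  subst hq
  have hn2' : (2 : ℝ) ≤ n := by exact_mod_cast hn2
  have hp_le : 1 ≤ n * p := by
    rw [← div_le_iff₀ hp0, hn]
    exact Nat.le_ceil _
  have hp_ge : ((n : ℝ) - 1) * p ≤ 1 := by
    rw [← le_div_iff₀ hp0, sub_le_iff_le_add, hn]
    exact (Nat.ceil_lt_add_one (by positivity)).le
  have hnF : n ≤ Fintype.card F := by
    have h : (n : ℝ) < Fintype.card F + 1 := by nlinarith [sq_nonneg ((n : ℝ) - 2)]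
    exact Nat.lt_succ_iff.1 (by exact_mod_cast h)
  have hcount : (n - 1) + (n - 1).choose 2 * (n - 1 - 2) < Fintype.card F := by
    have h : (((n - 1) + (n - 1).choose 2 * (n - 1 - 2) : ℕ) : ℝ) ≤
        ((n : ℝ) - 1) * (((n : ℝ) - 2) ^ 2 / 2 + 1) := by
      have h3 : ((n - 1 - 2 : ℕ) : ℝ) ≤ n - 2 := by
        have h : n - 1 - 2 + 2 ≤ n := by omega
        rw [le_sub_iff_add_le]
        exact_mod_cast h
      rw [Nat.cast_add, Nat.cast_mul, Nat.cast_choose_two, Nat.cast_sub (by omega : 1 ≤ n),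
        Nat.cast_one]
      have h4 : (0 : ℝ) ≤ ((n : ℝ) - 1) * (n - 1 - 1) / 2 := by
        have : (0 : ℝ) ≤ (n : ℝ) - 1 := by linarith
        have : (0 : ℝ) ≤ (n : ℝ) - 1 - 1 := by linarith
        positivity
      linarith [mul_le_mul_of_nonneg_left h3 h4]
    exact_mod_cast h.trans_lt hnq
  have hle := fun (r : F → ℝ) (a b : F → F) =>
    winProb_le (r := r) (by omega : 1 ≤ n) hnF hp_ge hp_le a b
  constructor
  · obtain ⟨T, hT, hTn⟩ := exists_isWeakSidon_card (F := F) n hcount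
    obtain ⟨r, a, b, hr0, hr1, hrp, h⟩ := exists_le_winProb hn2 hp0.le hp_ge hp_le hT hTn
    exact ⟨r, a, b, hr0, hr1, hrp, le_antisymm (hle r a b hr0 hr1 hrp) h⟩
  · rintro w ⟨r, a, b, hr0, hr1, hrp, rfl⟩
    exact hle r a b hr0 hr1 hrp
end
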